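/- arXiv:1601.02817 — 3 statements merged into one kernel-verified Lean document; each statement's English description precedes it below -/
import Mathlib

section
/- Let (x_n) be a weak greedy sequence with constant γ ∈ (0,1] for a compact set K in a Hilbert space X. If there exist α > 0 and C₀ > 0 such that the Kolmogorov widths satisfy d_n(K) ≤ C₀ n^{−α} for all n ∈ ℕ, then the greedy approximation errors satisfy σ_n(K) ≤ C₁ n^{−α} for all n ∈ ℕ, where C₁ = γ^{−2} 2^{5α+1} C₀. -/
open Metric

/-- A real square matrix satisfies `det² ≤ (‖B‖_F² / n) ^ n`. -/
theorem Matrix.det_sq_le_sum_sq_div_card_pow {ι : Type*} [Fintype ι] [DecidableEq ι] [Nonempty ι]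
    (B : Matrix ι ι ℝ) :
    B.det ^ 2 ≤ ((∑ i, ∑ j, B i j ^ 2) / Fintype.card ι) ^ Fintype.card ι := by
  have hP : (B * B.conjTranspose).PosSemidef := Matrix.posSemidef_self_mul_conjTranspose B
  have hdet : B.det ^ 2 = ∏ i, hP.isHermitian.eigenvalues i := by
    have h := hP.isHermitian.det_eq_prod_eigenvalues
    rw [Matrix.det_mul, Matrix.det_conjTranspose] at h
    simpa [sq] using h
  have htr : ∑ i, ∑ j, B i j ^ 2 = ∑ i, hP.isHermitian.eigenvalues i := by
    have h := hP.isHermitian.trace_eq_sum_eigenvalues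
    simpa [Matrix.trace, Matrix.mul_apply, sq] using h
  have hcard : (Fintype.card ι : ℝ) ≠ 0 := Nat.cast_ne_zero.mpr Fintype.card_ne_zero
  have hnn : 0 ≤ ∏ i, hP.isHermitian.eigenvalues i :=
    Finset.prod_nonneg fun i _ => hP.eigenvalues_nonneg i
  have amgm := Real.geom_mean_le_arith_mean Finset.univ (fun _ => 1)
    hP.isHermitian.eigenvalues (fun _ _ => zero_le_one) (by simp [Fintype.card_pos])
    (fun i _ => hP.eigenvalues_nonneg i)
  simp only [Real.rpow_one, one_mul, Finset.sum_const, Finset.card_univ, nsmul_eq_mul,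
    mul_one] at amgm
  rw [hdet, htr]
  calc ∏ i, hP.isHermitian.eigenvalues i
      = ((∏ i, hP.isHermitian.eigenvalues i) ^ (Fintype.card ι : ℝ)⁻¹) ^ Fintype.card ι := by
        rw [← Real.rpow_natCast, ← Real.rpow_mul hnn, inv_mul_cancel₀ hcard, Real.rpow_one]
    _ ≤ _ := pow_le_pow_left₀ (Real.rpow_nonneg hnn _) amgm _

/-- The squared determinant of the coordinates of a family of vectors does not depend on the
orthonormal basis. -/
theorem OrthonormalBasis.det_inner_sq_eq {ι E : Type*} [Fintype ι] [DecidableEq ι]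
    [NormedAddCommGroup E] [InnerProductSpace ℝ E] (e b : OrthonormalBasis ι ℝ E) (g : ι → E) :
    (Matrix.of fun i j => inner ℝ (g i) (e j)).det ^ 2 =
      (Matrix.of fun i j => inner ℝ (g i) (b j)).det ^ 2 := by
  have h (c : OrthonormalBasis ι ℝ E) :
      (Matrix.of fun i j => inner ℝ (g i) (c j)).det ^ 2 =
        (Matrix.of fun i j => inner ℝ (g i) (g j)).det := by
    rw [sq]
    nth_rw 2 [← Matrix.det_transpose]
    rw [← Matrix.det_mul]
    congr 1
    ext i j
    simp only [Matrix.mul_apply, Matrix.of_apply, Matrix.transpose_apply]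
    rw [← c.sum_inner_mul_inner (g i) (g j)]
    exact Finset.sum_congr rfl fun k _ => by rw [real_inner_comm (c k) (g j)]
  rw [h e, h b]

section

variable {X : Type*} [NormedAddCommGroup X] [InnerProductSpace ℝ X]

/-- Bessel's inequality for an orthonormal family orthogonal to a subspace. -/
theorem Orthonormal.sum_inner_sq_le_infDist_sq {ι : Type*} [Fintype ι] {u : ι → X}
    (hu : Orthonormal ℝ u) {V : Submodule ℝ X} (huV : ∀ j, ∀ v ∈ V, inner ℝ (u j) v = 0) (z : X) :
    ∑ j, inner ℝ z (u j) ^ 2 ≤ infDist z (V : Set X) ^ 2 := by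
  rw [← Real.sqrt_le_left infDist_nonneg, le_infDist V.nonempty]
  intro v hv
  apply Real.sqrt_le_iff.mpr ⟨dist_nonneg, ?_⟩
  have h := hu.sum_inner_products_le (z - v) (s := Finset.univ)
  rw [dist_eq_norm]
  refine le_of_eq_of_le (Finset.sum_congr rfl fun j _ => ?_) h
  rw [inner_sub_right, huV j v hv, sub_zero, Real.norm_eq_abs, sq_abs, real_inner_comm]

/-- A `2s`-dimensional space has an orthonormal basis whose last `s` vectors are orthogonal to a
given space of dimension at most `s`. -/
theorem Submodule.exists_orthonormalBasis_orthogonal {s : ℕ} (W Y : Submodule ℝ X)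
    [FiniteDimensional ℝ W] [FiniteDimensional ℝ Y] (hW : Module.finrank ℝ W = s + s)
    (hY : Module.finrank ℝ Y ≤ s) :
    ∃ b : OrthonormalBasis (Fin (s + s)) ℝ W,
      ∀ j : Fin s, ∀ y ∈ Y, inner ℝ (b (Fin.natAdd s j) : X) y = 0 := by
  let f : W →ₗ[ℝ] Y := Y.orthogonalProjectionOnto.toLinearMap ∘ₗ W.subtype
  have hker : s ≤ Module.finrank ℝ (LinearMap.ker f) := by
    have h₁ := f.finrank_range_add_finrank_ker
    have h₂ := (LinearMap.range f).finrank_le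
    lia
  let c := stdOrthonormalBasis ℝ (LinearMap.ker f)
  let v : Fin (s + s) → W :=
    Fin.addCases (fun _ => 0) fun j => (c (Fin.castLE hker j) : W)
  have hv (j : Fin s) : v (Fin.natAdd s j) = c (Fin.castLE hker j) := Fin.addCases_right j
  have hc : Orthonormal ℝ fun j : Fin s => (c (Fin.castLE hker j) : W) :=
    (c.orthonormal.comp_linearIsometry (LinearMap.ker f).subtypeₗᵢ).comp _
      (Fin.castLE_injective hker)
  have hvo : Orthonormal ℝ ((Set.range (Fin.natAdd s)).domRestrict v) := by
    rw [orthonormal_iff_ite] at hc ⊢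
    rintro ⟨_, i, rfl⟩ ⟨_, j, rfl⟩
    simpa [Set.domRestrict, hv, -Fin.natAdd_eq_addNat, Subtype.ext_iff, Fin.ext_iff] using hc i j
  obtain ⟨b, hb⟩ := Orthonormal.exists_orthonormalBasis_extension_of_card_eq
    (by simpa using hW) hvo
  refine ⟨b, fun j y hy => ?_⟩
  rw [hb _ ⟨j, rfl⟩, hv]
  have hmem : ((c (Fin.castLE hker j) : W) : X) ∈ Yᗮ := by
    rw [← Submodule.orthogonalProjectionOnto_eq_zero_iff]
    exact (c (Fin.castLE hker j)).2
  exact Submodule.inner_left_of_mem_orthogonal hy hmem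


/-- The distance to the span of the previous vectors is bounded by the length of the
Gram–Schmidt vector. -/
theorem infDist_span_image_Iio_le_norm_gramSchmidt (x : ℕ → X) (n : ℕ) :
    infDist (x n) (Submodule.span ℝ (x '' Set.Iio n) : Set X) ≤
      ‖InnerProductSpace.gramSchmidt ℝ x n‖ := by
  have hdef := InnerProductSpace.gramSchmidt_def'' ℝ x n
  have hmem : x n - InnerProductSpace.gramSchmidt ℝ x n ∈ Submodule.span ℝ (x '' Set.Iio n) := by
    rw [← InnerProductSpace.span_gramSchmidt_Iio]
    nth_rw 1 [hdef]
    rw [add_sub_cancel_left]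
    exact Submodule.sum_mem _ fun i hi => Submodule.smul_mem _ _
      (Submodule.subset_span ⟨i, Finset.mem_Iio.mp hi, rfl⟩)
  simpa [dist_eq_norm] using infDist_le_dist_of_mem (x := x n) hmem

theorem inner_gramSchmidtNormed_self (x : ℕ → X) (n : ℕ) :
    inner ℝ (x n) (InnerProductSpace.gramSchmidtNormed ℝ x n) =
      ‖InnerProductSpace.gramSchmidt ℝ x n‖ := by
  have h : inner ℝ (x n) (InnerProductSpace.gramSchmidt ℝ x n) =
      ‖InnerProductSpace.gramSchmidt ℝ x n‖ ^ 2 := by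
    nth_rw 1 [InnerProductSpace.gramSchmidt_def'' ℝ x n]
    rw [inner_add_left, sum_inner, real_inner_self_eq_norm_sq, Finset.sum_eq_zero, add_zero]
    intro i hi
    rw [real_inner_smul_left,
      InnerProductSpace.gramSchmidt_orthogonal ℝ x (Finset.mem_Iio.mp hi).ne, mul_zero]
  rw [InnerProductSpace.gramSchmidtNormed, inner_smul_right, h]
  by_cases h0 : ‖InnerProductSpace.gramSchmidt ℝ x n‖ = 0
  · simp [h0]
  · simp only [RCLike.ofReal_real_eq_id, id_eq]
    field_simp

/-- If `2s` consecutive vectors are `S`-close to the span of the first `M` vectors and `D`-close to a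
space of dimension at most `s`, then the product of their squared distances to the spans of the
preceding vectors is at most `(2SD)^(2s)`. -/
theorem prod_sq_le_two_mul_pow_of_le_infDist_span {s : ℕ} (hs : 0 < s) (x : ℕ → X) (M : ℕ)
    {S D : ℝ} {a : Fin (s + s) → ℝ} (hS : 0 < S) (hD : 0 < D) (ha : ∀ i, 0 < a i)
    (Y : Submodule ℝ X) [FiniteDimensional ℝ Y] (hY : Module.finrank ℝ Y ≤ s)
    (hxS : ∀ i < s + s, infDist (x (M + i)) (Submodule.span ℝ (x '' Set.Iio M) : Set X) ≤ S)
    (hxD : ∀ i < s + s, infDist (x (M + i)) (Y : Set X) ≤ D)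
    (hxa : ∀ i : Fin (s + s),
      a i ≤ infDist (x (M + i)) (Submodule.span ℝ (x '' Set.Iio (M + i)) : Set X)) :
    ∏ i, a i ^ 2 ≤ (2 * S * D) ^ (s + s) := by
  have : Nonempty (Fin (s + s)) := ⟨⟨0, by lia⟩⟩
  let e' : Fin (s + s) → X := fun i => InnerProductSpace.gramSchmidtNormed ℝ x (M + i)
  have hgs (i : Fin (s + s)) : a i ≤ ‖InnerProductSpace.gramSchmidt ℝ x (M + i)‖ :=
    (hxa i).trans (infDist_span_image_Iio_le_norm_gramSchmidt x _)
  have hne (i : Fin (s + s)) : InnerProductSpace.gramSchmidtNormed ℝ x (M + i) ≠ 0 := by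
    have h := norm_pos_iff.mp ((ha i).trans_le (hgs i))
    simpa [InnerProductSpace.gramSchmidtNormed] using h
  have he' : Orthonormal ℝ e' :=
    (InnerProductSpace.gramSchmidtNormed_orthonormal' (𝕜 := ℝ) x).comp
      (fun i : Fin (s + s) => ⟨M + i, hne i⟩)
      fun i j hij => Fin.ext (by simpa using hij)
  let W : Submodule ℝ X := Submodule.span ℝ (Set.range e')
  have : FiniteDimensional ℝ W := FiniteDimensional.span_of_finite ℝ (Set.finite_range e')
  let eb : Module.Basis (Fin (s + s)) ℝ W := Module.Basis.span he'.linearIndependent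
  have heb (i) : (eb i : X) = e' i := congrArg Subtype.val (Module.Basis.span_apply he'.linearIndependent i)
  let e : OrthonormalBasis (Fin (s + s)) ℝ W := eb.toOrthonormalBasis (by
    rw [orthonormal_iff_ite] at he' ⊢
    intro i j
    rw [Submodule.coe_inner, heb, heb, he'])
  have hee (i) : (e i : X) = e' i := by simp [e, heb]
  have hWfin : Module.finrank ℝ W = s + s := by
    simpa using Module.finrank_eq_card_basis eb
  obtain ⟨b, hbY⟩ := W.exists_orthonormalBasis_orthogonal Y hWfin hY
  let g : Fin (s + s) → W := fun i => W.orthogonalProjectionOnto (x (M + i))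
  have hg (i) (w : W) : inner ℝ (g i) w = inner ℝ (x (M + i)) (w : X) := by
    rw [real_inner_comm, Submodule.inner_orthogonalProjectionOnto_eq_of_mem_left, real_inner_comm]
  have hdet := e.det_inner_sq_eq b g
  have hlow : ∏ i, a i ^ 2 ≤ (Matrix.of fun i j => inner ℝ (g i) (e j)).det ^ 2 := by
    rw [Matrix.det_of_isLowerTriangular, ← Finset.prod_pow]
    · refine Finset.prod_le_prod (fun _ _ => sq_nonneg _) fun i _ => ?_
      rw [Matrix.of_apply, hg, hee, inner_gramSchmidtNormed_self]
      exact pow_le_pow_left₀ (ha i).le (hgs i) 2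
    · intro i j hij
      have hij' : i < j := hij
      rw [Matrix.of_apply, hg, hee]
      simp only [e', InnerProductSpace.gramSchmidtNormed]
      rw [inner_smul_right, real_inner_comm,
        InnerProductSpace.gramSchmidt_inv_triangular ℝ x (by simpa using hij'), mul_zero]
  let t : Fin (s + s) → ℝ := Fin.addCases (fun _ => S⁻¹) fun _ => D⁻¹
  have hbX : Orthonormal ℝ fun j => (b j : X) := b.orthonormal.comp_linearIsometry W.subtypeₗᵢ
  have hWM (w : W) : ∀ v ∈ Submodule.span ℝ (x '' Set.Iio M), inner ℝ (w : X) v = 0 := by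
    intro v hv
    have hle : W ≤ (Submodule.span ℝ (x '' Set.Iio M))ᗮ := by
      refine Submodule.span_le.mpr ?_
      rintro _ ⟨i, rfl⟩
      rw [← InnerProductSpace.span_gramSchmidt_Iio, SetLike.mem_coe, Submodule.mem_orthogonal']
      intro v hv
      induction hv using Submodule.span_induction with
      | mem v hv =>
        obtain ⟨k, hk, rfl⟩ := hv
        have hk' : M + (i : ℕ) ≠ k := by
          have := Set.mem_Iio.mp hk
          lia
        simp only [e', InnerProductSpace.gramSchmidtNormed]
        rw [real_inner_smul_left, InnerProductSpace.gramSchmidt_orthogonal ℝ x hk', mul_zero]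
      | zero => exact inner_zero_right _
      | add u v _ _ hu hv => rw [inner_add_right, hu, hv, add_zero]
      | smul c v _ hv => rw [inner_smul_right, hv, mul_zero]
    exact Submodule.inner_left_of_mem_orthogonal hv (hle w.2)
  have hrow (i : Fin (s + s)) : ∑ j, (t j * inner ℝ (g i) (b j)) ^ 2 ≤ 2 := by
    have h₁ : ∑ j : Fin s, inner ℝ (x (M + i)) (b (Fin.castAdd s j) : X) ^ 2 ≤ S ^ 2 :=
      ((hbX.comp _ (Fin.castAdd_injective s s)).sum_inner_sq_le_infDist_sq
        (fun j => hWM _) _).trans (pow_le_pow_left₀ infDist_nonneg (hxS i i.2) 2)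
    have h₂ : ∑ j : Fin s, inner ℝ (x (M + i)) (b (Fin.natAdd s j) : X) ^ 2 ≤ D ^ 2 :=
      ((hbX.comp _ (Fin.natAdd_injective s s)).sum_inner_sq_le_infDist_sq
        hbY _).trans (pow_le_pow_left₀ infDist_nonneg (hxD i i.2) 2)
    simp only [hg, Fin.sum_univ_add, t, Fin.addCases_left, Fin.addCases_right, mul_pow,
      ← Finset.mul_sum]
    have h₃ : S⁻¹ ^ 2 * S ^ 2 = 1 := by field_simp
    have h₄ : D⁻¹ ^ 2 * D ^ 2 = 1 := by field_simp
    have h₅ := mul_le_mul_of_nonneg_left h₁ (sq_nonneg S⁻¹)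
    have h₆ := mul_le_mul_of_nonneg_left h₂ (sq_nonneg D⁻¹)
    linarith
  have hup := Matrix.det_sq_le_sum_sq_div_card_pow
    (Matrix.of fun i j => t j * (Matrix.of fun i j => inner ℝ (g i) (b j)) i j)
  rw [Matrix.det_mul_row, Fin.prod_univ_add, mul_pow, ← hdet] at hup
  simp only [Matrix.of_apply, t, Fin.addCases_left, Fin.addCases_right, Finset.prod_const,
    Finset.card_univ, Fintype.card_fin] at hup
  have havg : (∑ i, ∑ j, (t j * inner ℝ (g i) (b j)) ^ 2) / ((s + s : ℕ) : ℝ) ≤ 2 := by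
    rw [div_le_iff₀ (by positivity)]
    refine (Finset.sum_le_sum fun i _ => hrow i).trans_eq ?_
    simp [mul_comm]
  calc ∏ i, a i ^ 2
      = (S * D) ^ (s + s) * ((S⁻¹ ^ s * D⁻¹ ^ s) ^ 2 * ∏ i, a i ^ 2) := by
        have h : (S * D) ^ (s + s) * (S⁻¹ ^ s * D⁻¹ ^ s) ^ 2 = 1 := by
          rw [← mul_two, pow_mul, ← mul_pow, ← mul_pow, ← mul_pow]
          have h' : S * D * (S⁻¹ * D⁻¹) = 1 := by field_simp
          simp [h']
        rw [← mul_assoc, h, one_mul]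
    _ ≤ (S * D) ^ (s + s) * 2 ^ (s + s) := by
        refine mul_le_mul_of_nonneg_left ?_ (by positivity)
        exact (mul_le_mul_of_nonneg_left hlow (sq_nonneg _)).trans
          (hup.trans (pow_le_pow_left₀ (by positivity) havg _))
    _ = (2 * S * D) ^ (s + s) := by rw [← mul_pow]; ring

theorem bddAbove_range_infDist {K : Set X} (hK : IsCompact K) (V : Submodule ℝ X) :
    BddAbove (Set.range fun y : K => infDist (y : X) (V : Set X)) := by
  obtain ⟨R, hR⟩ := hK.isBounded.exists_norm_le
  refine ⟨R, ?_⟩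
  rintro _ ⟨y, rfl⟩
  exact (infDist_le_dist_of_mem V.zero_mem).trans (by simpa using hR y y.2)

/-- If the infimum, over `s`-dimensional subspaces, of the maximal distance from a set is less than
`D > 0`, then some subspace of dimension at most `s` approximates the set within `D`. In a space
of dimension less than `s` the infimum is over the empty set, and the whole space works. -/
theorem exists_submodule_infDist_le {K : Set X} (hK : IsCompact K) {s : ℕ} {D : ℝ} (hD : 0 < D)
    (h : sInf {r : ℝ | ∃ Y : Submodule ℝ X, FiniteDimensional ℝ Y ∧
      Module.finrank ℝ Y = s ∧ r = ⨆ y : K, infDist (y : X) (Y : Set X)} < D) :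
    ∃ Y : Submodule ℝ X, FiniteDimensional ℝ Y ∧ Module.finrank ℝ Y ≤ s ∧
      ∀ y ∈ K, infDist y (Y : Set X) ≤ D := by
  by_cases hs : (s : Cardinal) ≤ Module.rank ℝ X
  · obtain ⟨v, hv⟩ := Module.le_rank_iff.mp hs
    have hne : ({r : ℝ | ∃ Y : Submodule ℝ X, FiniteDimensional ℝ Y ∧
        Module.finrank ℝ Y = s ∧ r = ⨆ y : K, infDist (y : X) (Y : Set X)}).Nonempty :=
      ⟨_, Submodule.span ℝ (Set.range v), FiniteDimensional.span_of_finite ℝ (Set.finite_range v),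
        by simpa using finrank_span_eq_card hv, rfl⟩
    obtain ⟨_, ⟨Y, hYfin, hY, rfl⟩, hlt⟩ := exists_lt_of_csInf_lt hne h
    exact ⟨Y, hYfin, hY.le, fun y hy =>
      (le_ciSup (bddAbove_range_infDist hK Y) (⟨y, hy⟩ : K)).trans hlt.le⟩
  · rw [not_le] at hs
    have hfin : FiniteDimensional ℝ X :=
      Module.rank_lt_aleph0_iff.mp (hs.trans Cardinal.natCast_lt_aleph0)
    refine ⟨⊤, inferInstance, ?_, fun y _ => ?_⟩
    · rw [finrank_top]
      exact Nat.cast_le.mp ((Module.finrank_eq_rank ℝ X).trans_le hs.le)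
    · rw [infDist_zero_of_mem (Submodule.mem_top : y ∈ (⊤ : Submodule ℝ X))]
      exact hD.le

end

/-- **Weak greedy algorithms preserve polynomial decay** (DeVore–Petrova–Wojtaszczyk).
If `(x n)` is a weak greedy sequence with constant `γ ∈ (0,1]` for a compact set `K` in a
Hilbert space and the Kolmogorov widths satisfy `d_n(K) ≤ C₀ n^{−α}`, then the greedy
errors satisfy `σ_n(K) ≤ C₁ n^{−α}` with `C₁ = γ⁻² 2^{5α+1} C₀`. -/
theorem weak_greedy_polynomial_decay
    {X : Type*} [NormedAddCommGroup X] [InnerProductSpace ℝ X] [CompleteSpace X]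
    (K : Set X) (hK : IsCompact K)
    (γ : ℝ) (hγ0 : 0 < γ) (hγ1 : γ ≤ 1)
    (x : ℕ → X) (hxK : ∀ n, x n ∈ K)
    (hgreedy : ∀ n : ℕ,
      γ * (⨆ y : K, infDist (y : X) (Submodule.span ℝ (x '' Set.Iio n) : Set X)) ≤
        infDist (x n) (Submodule.span ℝ (x '' Set.Iio n) : Set X))
    (α C₀ : ℝ) (hα : 0 < α) (hC₀ : 0 < C₀)
    (hd : ∀ n : ℕ, 0 < n →
      sInf {s : ℝ | ∃ Y : Submodule ℝ X, FiniteDimensional ℝ Y ∧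
          Module.finrank ℝ Y = n ∧ s = ⨆ y : K, infDist (y : X) (Y : Set X)} ≤
        C₀ * (n : ℝ) ^ (-α)) :
    ∀ n : ℕ, 0 < n →
      (⨆ y : K, infDist (y : X) (Submodule.span ℝ (x '' Set.Iio n) : Set X)) ≤
        γ⁻¹ ^ 2 * (2 : ℝ) ^ (5 * α + 1) * C₀ * (n : ℝ) ^ (-α) := by
  have : Nonempty K := ⟨⟨x 0, hxK 0⟩⟩
  set σ : ℕ → ℝ := fun n =>
    ⨆ y : K, infDist (y : X) (Submodule.span ℝ (x '' Set.Iio n) : Set X) with hσ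
  have hle (n : ℕ) {y : X} (hy : y ∈ K) :
      infDist y (Submodule.span ℝ (x '' Set.Iio n) : Set X) ≤ σ n :=
    le_ciSup (bddAbove_range_infDist hK _) (⟨y, hy⟩ : K)
  have hσ0 (n : ℕ) : 0 ≤ σ n := Real.iSup_nonneg fun _ => infDist_nonneg
  have hanti : Antitone σ := fun m n hmn => ciSup_mono (bddAbove_range_infDist hK _) fun y =>
    infDist_le_infDist_of_subset
      (Submodule.span_mono (Set.image_mono (Set.Iio_subset_Iio hmn))) (Submodule.nonempty _)
  have hprod (M s : ℕ) (hs : 0 < s) (hpos : 0 < σ (M + (s + s) - 1)) :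
      ∏ i : Fin (s + s), (γ * σ (M + i)) ^ 2 ≤
        (2 * σ M * (C₀ * (s : ℝ) ^ (-α))) ^ (s + s) := by
    have hcont : Filter.Tendsto (fun D : ℝ => (2 * σ M * D) ^ (s + s))
        (nhdsWithin (C₀ * (s : ℝ) ^ (-α)) (Set.Ioi (C₀ * (s : ℝ) ^ (-α))))
        (nhds ((2 * σ M * (C₀ * (s : ℝ) ^ (-α))) ^ (s + s))) :=
      ((continuous_const.mul continuous_id).pow _).continuousWithinAt
    refine ge_of_tendsto hcont ?_
    filter_upwards [self_mem_nhdsWithin] with D hD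
    have hDpos : 0 < D := lt_of_le_of_lt (by positivity) hD
    obtain ⟨Y, hYfin, hY, hYD⟩ := exists_submodule_infDist_le hK hDpos ((hd s hs).trans_lt hD)
    exact prod_sq_le_two_mul_pow_of_le_infDist_span hs x M
      (hpos.trans_le (hanti (by lia))) hDpos
      (fun i => mul_pos hγ0 (hpos.trans_le (hanti (by lia)))) Y hY
      (fun i _ => hle M (hxK _)) (fun i _ => hYD _ (hxK _)) fun i => hgreedy _
  set c : ℝ := γ⁻¹ ^ 2 * C₀ with hc
  have hcpos : 0 < c := by positivity
  have hC₀c : C₀ = γ ^ 2 * c := by rw [hc]; field_simp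
  set p : ℝ := (2 : ℝ) ^ α with hp
  have hppos : 0 < p := by positivity
  have hp1 : 1 ≤ p := Real.one_le_rpow one_le_two hα.le
  have hC₁ : γ⁻¹ ^ 2 * (2 : ℝ) ^ (5 * α + 1) * C₀ = 2 * c * p ^ 5 := by
    have h : (2 : ℝ) ^ (5 * α + 1) = 2 * p ^ 5 := by
      rw [Real.rpow_add two_pos, Real.rpow_one, hp, ← Real.rpow_natCast, ← Real.rpow_mul two_pos.le]
      push_cast
      ring_nf
    rw [h, hc]
    ring
  have hscale (k s : ℕ) :
      ((2 ^ k * s : ℕ) : ℝ) ^ (-α) = (p ^ k)⁻¹ * (s : ℝ) ^ (-α) := by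
    push_cast
    rw [Real.mul_rpow (by positivity) (by positivity), Real.rpow_neg (by positivity), hp,
      ← Real.rpow_natCast, ← Real.rpow_natCast, ← Real.rpow_mul two_pos.le,
      ← Real.rpow_mul two_pos.le, mul_comm α]
  have hone : σ 1 ≤ 2 * c := by
    by_contra! hlt
    have h1 : 0 < σ 1 := lt_trans (by positivity) hlt
    have h0 : 0 < σ 0 := h1.trans_le (hanti zero_le_one)
    have h := hprod 0 1 one_pos (by simpa using h1)
    simp only [Fin.prod_univ_two, Nat.cast_one, Real.one_rpow, Fin.val_zero, Fin.val_one,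
      Nat.reduceAdd, zero_add, mul_one, ← mul_pow] at h
    have h' := le_of_sq_le_sq h (by positivity)
    rw [hC₀c] at h'
    have h'' : γ ^ 2 * σ 0 * σ 1 ≤ γ ^ 2 * σ 0 * (2 * c) := by linarith
    exact hlt.not_ge (le_of_mul_le_mul_left h'' (by positivity))
  have hfour (s : ℕ) (hs : 0 < s) :
      σ (4 * s) ^ 2 ≤ 2 * c * σ (2 * s) * (s : ℝ) ^ (-α) := by
    have hanti4 : σ (4 * s) ≤ σ (2 * s + (s + s) - 1) := hanti (by lia)
    refine (pow_le_pow_left₀ (hσ0 _) hanti4 2).trans ?_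
    rcases (hσ0 (2 * s + (s + s) - 1)).eq_or_lt with h0 | hpos
    · rw [← h0, zero_pow two_ne_zero]
      have := hσ0 (2 * s)
      positivity
    have hlow : ((γ * σ (2 * s + (s + s) - 1)) ^ 2) ^ (s + s) ≤
        ∏ i : Fin (s + s), (γ * σ (2 * s + i)) ^ 2 := by
      have h := Finset.prod_le_prod (s := (Finset.univ : Finset (Fin (s + s))))
        (f := fun _ => (γ * σ (2 * s + (s + s) - 1)) ^ 2)
        (g := fun i : Fin (s + s) => (γ * σ (2 * s + i)) ^ 2) (fun _ _ => sq_nonneg _) fun i _ =>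
          pow_le_pow_left₀ (by positivity)
            (mul_le_mul_of_nonneg_left (hanti (by lia)) hγ0.le) 2
      simpa using h
    have h := le_of_pow_le_pow_left₀ (by lia)
      (mul_nonneg (mul_nonneg two_pos.le (hσ0 _)) (by positivity))
      (hlow.trans (hprod (2 * s) s hs hpos))
    rw [hC₀c, mul_pow] at h
    refine le_of_mul_le_mul_left (h.trans_eq ?_) (pow_pos hγ0 2)
    ring
  rw [hC₁]
  intro n
  induction n using Nat.strong_induction_on with
  | _ n ih =>
  intro hn
  change σ n ≤ _
  rcases lt_or_ge n 4 with hn4 | hn4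
  · have h4 : ((2 ^ 2 * 1 : ℕ) : ℝ) ^ (-α) ≤ (n : ℝ) ^ (-α) :=
      Real.rpow_le_rpow_of_nonpos (by positivity) (by exact_mod_cast hn4.le) (by linarith)
    rw [hscale, Nat.cast_one, Real.one_rpow, mul_one] at h4
    calc σ n ≤ 2 * c := (hanti hn).trans hone
      _ ≤ 2 * c * p ^ 3 := le_mul_of_one_le_right (by positivity) (one_le_pow₀ hp1)
      _ = 2 * c * p ^ 5 * (p ^ 2)⁻¹ := by field_simp
      _ ≤ _ := by gcongr
  · have hs : 0 < n / 4 := by lia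
    set s := n / 4
    have h8 : ((2 ^ 3 * s : ℕ) : ℝ) ^ (-α) ≤ (n : ℝ) ^ (-α) :=
      Real.rpow_le_rpow_of_nonpos (by positivity) (by exact_mod_cast (by lia)) (by linarith)
    have ihs : σ (2 * s) ≤ 2 * c * p ^ 5 * ((2 ^ 1 * s : ℕ) : ℝ) ^ (-α) := by
      simpa using ih (2 * s) (by lia) (by lia)
    rw [hscale] at h8 ihs
    set u : ℝ := (s : ℝ) ^ (-α)
    have hu : 0 ≤ u := by positivity
    have hsq : σ (4 * s) ^ 2 ≤ (2 * c * p ^ 2 * u) ^ 2 :=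
      calc σ (4 * s) ^ 2 ≤ 2 * c * σ (2 * s) * u := hfour s hs
        _ ≤ 2 * c * (2 * c * p ^ 5 * ((p ^ 1)⁻¹ * u)) * u := by gcongr
        _ = (2 * c * p ^ 2 * u) ^ 2 := by field_simp
    calc σ n ≤ σ (4 * s) := hanti (by lia)
      _ ≤ 2 * c * p ^ 2 * u := le_of_sq_le_sq hsq (by positivity)
      _ = 2 * c * p ^ 5 * ((p ^ 3)⁻¹ * u) := by field_simp
      _ ≤ _ := by gcongr
end

section
/- Let X and V be complex Banach spaces, O ⊂ X an open set, and u : O → V a holomorphic (analytic) map that is uniformly bounded on O. Let K ⊂ O be a compact subset of X and let α > 1 and C₀ > 0 be such that the Kolmogorov widths satisfy d_n(K) ≤ C₀ n^{−α} for all n ∈ ℕ. Then for every β with 0 < β < α − 1 there exists a constant C₁ > 0 (depending on C₀, α, β and u) such that d_n(u(K)) ≤ C₁ n^{−β} for all n ∈ ℕ. -/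
open Metric Filter Topology

section Holomorphic

variable {E F : Type*} [NormedAddCommGroup E] [NormedSpace ℂ E]
  [NormedAddCommGroup F] [NormedSpace ℂ F]

/-- Cauchy estimate for the derivative of a bounded holomorphic map on a ball. -/
theorem norm_fderiv_le_of_forall_mem_ball {f : E → F} {x : E} {R M : ℝ}
    (hR : 0 < R) (hf : DifferentiableOn ℂ f (ball x R)) (hM : ∀ y ∈ ball x R, ‖f y‖ ≤ M) :
    ‖fderiv ℂ f x‖ ≤ 2 * M / R := by
  refine Complex.norm_fderiv_le_div_of_mapsTo_ball hf (fun y hy ↦ ?_) hR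
  rw [mem_closedBall, dist_eq_norm]
  linarith [norm_sub_le (f y) (f x), hM y hy, hM x (mem_ball_self hR)]

theorem ball_subset_ball_of_mem_half {E : Type*} [PseudoMetricSpace E] {x y : E} {R : ℝ}
    (hy : y ∈ ball x (R / 2)) : ball y (R / 2) ⊆ ball x R :=
  ball_subset_ball' (by rw [mem_ball] at hy; linarith)

theorem norm_fderiv_le_of_mem_ball_half {f : E → F} {x : E} {R M : ℝ}
    (hR : 0 < R) (hf : DifferentiableOn ℂ f (ball x R)) (hM : ∀ y ∈ ball x R, ‖f y‖ ≤ M)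
    {y : E} (hy : y ∈ ball x (R / 2)) : ‖fderiv ℂ f y‖ ≤ 4 * M / R := by
  have hsub := ball_subset_ball_of_mem_half hy
  refine (norm_fderiv_le_of_forall_mem_ball (half_pos hR) (hf.mono hsub)
    fun z hz ↦ hM z (hsub hz)).trans_eq ?_
  field_simp
  ring

theorem norm_fderiv_sub_le_of_forall_mem_ball {f : E → F} {x : E} {R M : ℝ}
    (hR : 0 < R) (hf : DifferentiableOn ℂ f (ball x R)) (hM : ∀ y ∈ ball x R, ‖f y‖ ≤ M)
    {y : E} (hy : y ∈ ball x (R / 4)) :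
    ‖fderiv ℂ f y - fderiv ℂ f x‖ ≤ 32 * M / R ^ 2 * ‖y - x‖ := by
  have hd : ∀ z ∈ ball x R, DifferentiableAt ℂ f z := fun z hz ↦
    hf.differentiableAt (isOpen_ball.mem_nhds hz)
  have hyn : ‖y - x‖ < R / 4 := by rwa [mem_ball, dist_eq_norm] at hy
  have hshift : ∀ z ∈ ball x (R / 4), z + (y - x) ∈ ball x (R / 2) := fun z hz ↦ by
    rw [mem_ball, dist_eq_norm] at hz ⊢
    calc ‖z + (y - x) - x‖ = ‖(z - x) + (y - x)‖ := by congr 1; abel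
      _ ≤ ‖z - x‖ + ‖y - x‖ := norm_add_le _ _
      _ < R / 2 := by linarith
  have h2 : ball x (R / 2) ⊆ ball x R := ball_subset_ball (by linarith)
  have h4 : ball x (R / 4) ⊆ ball x (R / 2) := ball_subset_ball (by linarith)
  have hdz : ∀ z ∈ ball x (R / 4), DifferentiableAt ℂ (fun z ↦ f (z + (y - x))) z := fun z hz ↦
    (differentiableAt_comp_add_right _).2 (hd _ (h2 (hshift z hz)))
  have key := norm_fderiv_le_of_forall_mem_ball (f := fun z ↦ f (z + (y - x)) - f z) (x := x)
    (R := R / 4) (M := 4 * M / R * ‖y - x‖) (by linarith)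
    (fun z hz ↦ ((hdz z hz).sub (hd z (h2 (h4 hz)))).differentiableWithinAt)
    (fun z hz ↦ by
      have := (convex_ball x (R / 2)).norm_image_sub_le_of_norm_fderiv_le (𝕜 := ℂ)
        (fun w hw ↦ hd w (h2 hw)) (fun w hw ↦ norm_fderiv_le_of_mem_ball_half hR hf hM hw)
        (h4 hz) (hshift z hz)
      simpa using this)
  have hx : x ∈ ball x (R / 4) := mem_ball_self (by linarith)
  rw [fderiv_fun_sub (hdz x hx) (hd x (h2 (h4 hx))), fderiv_comp_add_right,
    add_sub_cancel] at key
  refine key.trans_eq ?_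
  field_simp
  ring

/-- Second order Taylor estimate for a bounded holomorphic map on a ball. -/
theorem norm_sub_sub_fderiv_le_of_forall_mem_ball {f : E → F} {x : E} {R M : ℝ}
    (hR : 0 < R) (hf : DifferentiableOn ℂ f (ball x R)) (hM : ∀ y ∈ ball x R, ‖f y‖ ≤ M)
    {w : E} (hw : ‖w‖ < R / 4) :
    ‖f (x + w) - f x - fderiv ℂ f x w‖ ≤ 32 * M / R ^ 2 * ‖w‖ ^ 2 := by
  have hM0 : 0 ≤ M := (norm_nonneg _).trans (hM x (mem_ball_self hR))
  have hsub : closedBall x ‖w‖ ⊆ ball x (R / 4) := closedBall_subset_ball hw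
  have hsub' : ball x (R / 4) ⊆ ball x R := ball_subset_ball (by linarith)
  have := (convex_closedBall x ‖w‖).norm_image_sub_le_of_norm_fderiv_le' (𝕜 := ℂ) (f := f)
    (φ := fderiv ℂ f x) (C := 32 * M / R ^ 2 * ‖w‖) (x := x) (y := x + w)
    (fun z hz ↦ hf.differentiableAt (isOpen_ball.mem_nhds (hsub' (hsub hz))))
    (fun z hz ↦ (norm_fderiv_sub_le_of_forall_mem_ball hR hf hM (hsub hz)).trans (by
      rw [mem_closedBall, dist_eq_norm] at hz
      gcongr))
    (mem_closedBall_self (norm_nonneg _)) (by simp)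
  rw [add_sub_cancel_left] at this
  exact this.trans_eq (by ring)

/-- A uniform limit of holomorphic maps on a ball is differentiable at the center. -/
theorem differentiableAt_of_tendstoUniformlyOn_ball [CompleteSpace F] {f : ℕ → E → F} {g : E → F}
    {x : E} {R : ℝ} (hR : 0 < R) (hf : ∀ n, DifferentiableOn ℂ (f n) (ball x R))
    (hg : TendstoUniformlyOn f g atTop (ball x R)) : DifferentiableAt ℂ g x := by
  have h2 : ball x (R / 2) ⊆ ball x R := ball_subset_ball (by linarith)
  have hd : ∀ n, ∀ z ∈ ball x R, DifferentiableAt ℂ (f n) z := fun n z hz ↦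
    (hf n).differentiableAt (isOpen_ball.mem_nhds hz)
  have hC : UniformCauchySeqOn (fun n ↦ fderiv ℂ (f n)) atTop (ball x (R / 2)) := by
    rw [Metric.uniformCauchySeqOn_iff]
    intro ε hε
    obtain ⟨N, hN⟩ := Metric.uniformCauchySeqOn_iff.1 hg.uniformCauchySeqOn (ε * R / 8)
      (by positivity)
    refine ⟨N, fun m hm n hn z hz ↦ ?_⟩
    rw [dist_eq_norm, ← fderiv_sub (hd m z (h2 hz)) (hd n z (h2 hz))]
    refine (norm_fderiv_le_of_mem_ball_half (M := ε * R / 8) hR ((hf m).sub (hf n))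
      (fun y hy ↦ ?_) hz).trans_lt ?_
    · have := hN m hm n hn y hy
      rw [dist_eq_norm] at this
      exact this.le
    · field_simp
      linarith
  have hlim : ∀ z ∈ ball x (R / 2), ∃ L, Tendsto (fun n ↦ fderiv ℂ (f n) z) atTop (𝓝 L) :=
    fun z hz ↦ cauchySeq_tendsto_of_complete (hC.cauchySeq hz)
  choose! g' hg' using hlim
  exact (hasFDerivAt_of_tendstoUniformlyOn isOpen_ball (hC.tendstoUniformlyOn_of_tendsto hg')
    (fun n z hz ↦ (hd n z (h2 hz)).hasFDerivAt) (fun z hz ↦ hg.tendsto_at (h2 hz))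
    (mem_ball_self (half_pos hR))).differentiableAt

/-- Directional derivatives of a bounded holomorphic map are holomorphic. -/
theorem differentiableAt_fderiv_apply [CompleteSpace F] {f : E → F} {x : E} {R M : ℝ}
    (hR : 0 < R) (hf : DifferentiableOn ℂ f (ball x R)) (hM : ∀ y ∈ ball x R, ‖f y‖ ≤ M) (v : E) :
    DifferentiableAt ℂ (fun y ↦ fderiv ℂ f y v) x := by
  have hM0 : 0 ≤ M := (norm_nonneg _).trans (hM x (mem_ball_self hR))
  have hd : ∀ z ∈ ball x R, DifferentiableAt ℂ f z := fun z hz ↦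
    hf.differentiableAt (isOpen_ball.mem_nhds hz)
  have hsub : ball x (R / 2) ⊆ ball x R := ball_subset_ball (by linarith)
  set t : ℕ → ℝ := fun n ↦ R / (8 * (‖v‖ + 1)) * (1 / ((n : ℝ) + 1)) with ht
  have ht0 : ∀ n, 0 < t n := fun n ↦ by positivity
  have htv : ∀ n, ‖((t n : ℝ) : ℂ) • v‖ < R / 2 / 4 := fun n ↦ by
    have hn : 1 / ((n : ℝ) + 1) ≤ 1 := by
      rw [div_le_one (by positivity)]
      linarith [(Nat.cast_nonneg n : (0 : ℝ) ≤ n)]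
    rw [norm_smul, Complex.norm_real, Real.norm_of_nonneg (ht0 n).le]
    calc t n * ‖v‖ ≤ R / (8 * (‖v‖ + 1)) * 1 * ‖v‖ := by
          simp only [ht]
          gcongr
      _ < R / 2 / 4 := by
          field_simp
          nlinarith [norm_nonneg v]
  have htlim : Tendsto t atTop (𝓝 0) := by
    simpa only [mul_zero] using
      tendsto_one_div_add_atTop_nhds_zero_nat.const_mul (R / (8 * (‖v‖ + 1)))
  refine differentiableAt_of_tendstoUniformlyOn_ball (R := R / 2) (half_pos hR)
    (f := fun n y ↦ ((t n : ℝ) : ℂ)⁻¹ • (f (y + ((t n : ℝ) : ℂ) • v) - f y)) (fun n y hy ↦ ?_) ?_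
  · refine DifferentiableAt.differentiableWithinAt (((?_ : DifferentiableAt ℂ _ y).sub
      (hd y (hsub hy))).const_smul _)
    refine (differentiableAt_comp_add_right _).2 (hd _ (ball_subset_ball_of_mem_half hy ?_))
    rw [mem_ball, dist_eq_norm, add_sub_cancel_left]
    linarith [htv n]
  · rw [Metric.tendstoUniformlyOn_iff]
    intro ε hε
    have hlim : Tendsto (fun n ↦ 32 * M / (R / 2) ^ 2 * ‖v‖ ^ 2 * t n) atTop (𝓝 0) := by
      simpa using htlim.const_mul (32 * M / (R / 2) ^ 2 * ‖v‖ ^ 2)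
    filter_upwards [hlim.eventually_lt_const hε] with n hn y hy
    refine lt_of_le_of_lt ?_ hn
    have hy' := ball_subset_ball_of_mem_half hy
    have key := norm_sub_sub_fderiv_le_of_forall_mem_ball (half_pos hR) (hf.mono hy')
      (fun z hz ↦ hM z (hy' hz)) (htv n)
    have htc : ((t n : ℝ) : ℂ) ≠ 0 := by exact_mod_cast (ht0 n).ne'
    rw [dist_comm, dist_eq_norm]
    have : ((t n : ℝ) : ℂ)⁻¹ • (f (y + ((t n : ℝ) : ℂ) • v) - f y) - fderiv ℂ f y v =
        ((t n : ℝ) : ℂ)⁻¹ • (f (y + ((t n : ℝ) : ℂ) • v) - f y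
          - fderiv ℂ f y (((t n : ℝ) : ℂ) • v)) := by
      rw [map_smul, smul_sub (_ : ℂ) (_ - _), inv_smul_smul₀ htc]
    rw [this, norm_smul, norm_inv, Complex.norm_real, Real.norm_of_nonneg (ht0 n).le]
    rw [norm_smul, Complex.norm_real, Real.norm_of_nonneg (ht0 n).le] at key
    calc (t n)⁻¹ * _ ≤ (t n)⁻¹ * (32 * M / (R / 2) ^ 2 * (t n * ‖v‖) ^ 2) := by
          have := (ht0 n).le
          gcongr
      _ = _ := by
          have := (ht0 n).ne'
          field_simp

theorem differentiableAt_fderiv_of_forall_mem_ball [CompleteSpace F] {f : E → F} {x : E} {R M : ℝ}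
    (hR : 0 < R) (hf : DifferentiableOn ℂ f (ball x R)) (hM : ∀ y ∈ ball x R, ‖f y‖ ≤ M) :
    DifferentiableAt ℂ (fderiv ℂ f) x := by
  have hM0 : 0 ≤ M := (norm_nonneg _).trans (hM x (mem_ball_self hR))
  have hg : ∀ v, ∀ y ∈ ball x (R / 2), DifferentiableAt ℂ (fun y ↦ fderiv ℂ f y v) y := by
    intro v y hy
    have hy' := ball_subset_ball_of_mem_half hy
    exact differentiableAt_fderiv_apply (half_pos hR) (hf.mono hy') (fun z hz ↦ hM z (hy' hz)) v
  have hgx : ∀ v, DifferentiableAt ℂ (fun y ↦ fderiv ℂ f y v) x := fun v ↦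
    hg v x (mem_ball_self (half_pos hR))
  have hgd : ∀ v, DifferentiableOn ℂ (fun y ↦ fderiv ℂ f y v) (ball x (R / 2)) := fun v y hy ↦
    (hg v y hy).differentiableWithinAt
  have hgb : ∀ v, ∀ y ∈ ball x (R / 2), ‖fderiv ℂ f y v‖ ≤ 4 * M / R * ‖v‖ := fun v y hy ↦
    (fderiv ℂ f y).le_of_opNorm_le (norm_fderiv_le_of_mem_ball_half hR hf hM hy) v
  let B : E →L[ℂ] E →L[ℂ] F := LinearMap.mkContinuous₂
    (LinearMap.mk₂ ℂ (fun w v ↦ fderiv ℂ (fun y ↦ fderiv ℂ f y v) x w)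
      (fun _ _ _ ↦ map_add _ _ _) (fun _ _ _ ↦ map_smul _ _ _)
      (fun w v v' ↦ by
        simp only [map_add]
        rw [fderiv_fun_add (hgx v) (hgx v')]
        rfl)
      (fun c w v ↦ by
        simp only [map_smul]
        rw [fderiv_fun_const_smul (hgx v)]
        rfl))
    (2 * (4 * M / R) / (R / 2)) (fun w v ↦ by
      refine ((fderiv ℂ (fun y ↦ fderiv ℂ f y v) x).le_of_opNorm_le
        (norm_fderiv_le_of_forall_mem_ball (half_pos hR) (hgd v) (hgb v)) w).trans_eq ?_
      ring)
  have hB : ∀ w v, B w v = fderiv ℂ (fun y ↦ fderiv ℂ f y v) x w := fun w v ↦ rfl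
  refine HasFDerivAt.differentiableAt (f' := B) ?_
  rw [hasFDerivAt_iff_isLittleO_nhds_zero]
  refine Asymptotics.IsBigO.trans_isLittleO (g := fun w : E ↦ ‖w‖ ^ 2) ?_
    (Asymptotics.isLittleO_norm_pow_id one_lt_two)
  refine Asymptotics.IsBigO.of_bound (32 * (4 * M / R) / (R / 2) ^ 2) ?_
  filter_upwards [ball_mem_nhds (0 : E) (show 0 < R / 2 / 4 by positivity)] with w hw
  rw [mem_ball_zero_iff] at hw
  rw [norm_pow, norm_norm]
  refine ContinuousLinearMap.opNorm_le_bound _ (by positivity) fun v ↦ ?_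
  refine (norm_sub_sub_fderiv_le_of_forall_mem_ball (half_pos hR) (hgd v) (hgb v) hw).trans_eq ?_
  ring

/-- The derivative of a holomorphic map is holomorphic. -/
theorem DifferentiableOn.fderiv_of_isOpen [CompleteSpace F] {f : E → F} {s : Set E}
    (hf : DifferentiableOn ℂ f s) (hs : IsOpen s) : DifferentiableOn ℂ (fderiv ℂ f) s := by
  intro x hx
  have hcont := (hf.differentiableAt (hs.mem_nhds hx)).continuousAt
  have hbd : ∀ᶠ y in 𝓝 x, ‖f y‖ < ‖f x‖ + 1 :=
    hcont.norm.eventually_lt_const (lt_add_one _)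
  obtain ⟨R, hR, hRs⟩ := Metric.mem_nhds_iff.1 (inter_mem (hs.mem_nhds hx) hbd)
  exact (differentiableAt_fderiv_of_forall_mem_ball hR (hf.mono fun y hy ↦ (hRs hy).1)
    fun y hy ↦ (hRs hy).2.le).differentiableWithinAt

theorem DifferentiableOn.iteratedFDeriv_of_isOpen [CompleteSpace F] {f : E → F} {s : Set E}
    (hf : DifferentiableOn ℂ f s) (hs : IsOpen s) (n : ℕ) :
    DifferentiableOn ℂ (iteratedFDeriv ℂ n f) s := by
  induction n with
  | zero =>
    rw [iteratedFDeriv_zero_eq_comp]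
    exact (LinearIsometryEquiv.differentiable _).comp_differentiableOn hf
  | succ n ih =>
    rw [iteratedFDeriv_succ_eq_comp_left]
    exact (LinearIsometryEquiv.differentiable _).comp_differentiableOn (ih.fderiv_of_isOpen hs)

/-- Cauchy estimates for all derivatives of a bounded holomorphic map on a ball. -/
theorem norm_iteratedFDeriv_le_of_forall_mem_ball [CompleteSpace F] {f : E → F} {x : E} {R M : ℝ}
    (hR : 0 < R) (hf : DifferentiableOn ℂ f (ball x R)) (hM : ∀ y ∈ ball x R, ‖f y‖ ≤ M) (k : ℕ) :
    ‖iteratedFDeriv ℂ k f x‖ ≤ M * (2 * (k + 1) / R) ^ k := by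
  set ρ : ℝ := R / (k + 1) with hρ
  have hρ0 : 0 < ρ := by positivity
  have hRρ : R = (k + 1) * ρ := by
    rw [hρ]
    field_simp
  have key : ∀ j : ℕ, ∀ y ∈ ball x (R - j * ρ),
      ‖iteratedFDeriv ℂ j f y‖ ≤ M * (2 / ρ) ^ j := by
    intro j
    induction j with
    | zero =>
      intro y hy
      simpa using hM y (by simpa using hy)
    | succ j ih =>
      intro y hy
      have hsub : ball y ρ ⊆ ball x (R - j * ρ) := by
        refine ball_subset_ball' ?_
        rw [mem_ball] at hy
        push_cast at hy
        linarith
      have hsub' : ball x (R - j * ρ) ⊆ ball x R :=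
        ball_subset_ball (sub_le_self _ (by positivity))
      rw [← norm_fderiv_iteratedFDeriv]
      refine (norm_fderiv_le_of_forall_mem_ball hρ0
        ((hf.iteratedFDeriv_of_isOpen isOpen_ball j).mono (hsub.trans hsub'))
        fun z hz ↦ ih z (hsub hz)).trans_eq ?_
      ring
  refine (key k x (mem_ball_self ?_)).trans_eq ?_
  · rw [hRρ]
    linarith
  · rw [hρ]
    field_simp

theorem iteratedDeriv_comp_add_smul [CompleteSpace F] {f : E → F} {s : Set E}
    (hf : DifferentiableOn ℂ f s) (hs : IsOpen s) (x h : E) (k : ℕ) {t : ℂ} (ht : x + t • h ∈ s) :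
    iteratedDeriv k (fun t : ℂ ↦ f (x + t • h)) t =
      iteratedFDeriv ℂ k f (x + t • h) fun _ ↦ h := by
  induction k generalizing t with
  | zero => simp
  | succ k ih =>
    have hline : HasDerivAt (fun t : ℂ ↦ x + t • h) h t := by
      simpa using ((hasDerivAt_id t).smul_const h).const_add x
    have hev : iteratedDeriv k (fun t : ℂ ↦ f (x + t • h)) =ᶠ[𝓝 t]
        fun t ↦ iteratedFDeriv ℂ k f (x + t • h) fun _ ↦ h := by
      filter_upwards [hline.continuousAt.preimage_mem_nhds (hs.mem_nhds ht)] with t' ht'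
      exact ih ht'
    have hd : HasFDerivAt (iteratedFDeriv ℂ k f) (fderiv ℂ (iteratedFDeriv ℂ k f) (x + t • h))
        (x + t • h) :=
      ((hf.iteratedFDeriv_of_isOpen hs k).differentiableAt (hs.mem_nhds ht)).hasFDerivAt
    rw [iteratedDeriv_succ, hev.deriv_eq, iteratedFDeriv_succ_apply_left]
    have h1 := (ContinuousMultilinearMap.apply ℂ (fun _ : Fin k ↦ E) F
      (fun _ ↦ h)).hasFDerivAt.comp_hasDerivAt t (hd.comp_hasDerivAt t hline)
    exact h1.deriv

/-- A bounded holomorphic map on a ball is the sum of a series of homogeneous polynomials whose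
norms grow at most geometrically. -/
theorem exists_hasSum_multilinear_of_forall_mem_ball [CompleteSpace F] {f : E → F} {x : E}
    {R M : ℝ} (hR : 0 < R) (hf : DifferentiableOn ℂ f (ball x R))
    (hM : ∀ y ∈ ball x R, ‖f y‖ ≤ M) :
    ∃ (a B : ℝ) (p : ∀ k : ℕ, ContinuousMultilinearMap ℂ (fun _ : Fin k ↦ E) F), 0 < a ∧ 0 ≤ B ∧
      (∀ k, ‖p k‖ ≤ B * a ^ k) ∧
      ∀ h : E, a * ‖h‖ < 1 → HasSum (fun k ↦ p k fun _ ↦ h) (f (x + h)) := by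
  have hM0 : 0 ≤ M := (norm_nonneg _).trans (hM x (mem_ball_self hR))
  refine ⟨2 * Real.exp 1 / R, M * Real.exp 1,
    fun k ↦ (k.factorial : ℂ)⁻¹ • iteratedFDeriv ℂ k f x, by positivity, by positivity,
    fun k ↦ ?_, fun h hh ↦ ?_⟩
  · have hexp := Real.pow_div_factorial_le_exp (x := (k : ℝ) + 1) (by positivity) k
    rw [Real.exp_add, ← Real.exp_one_pow] at hexp
    rw [norm_smul, norm_inv, Complex.norm_natCast]
    calc (k.factorial : ℝ)⁻¹ * ‖iteratedFDeriv ℂ k f x‖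
        ≤ (k.factorial : ℝ)⁻¹ * (M * (2 * (k + 1) / R) ^ k) := by
          gcongr
          exact norm_iteratedFDeriv_le_of_forall_mem_ball hR hf hM k
      _ = M * (2 / R) ^ k * (((k : ℝ) + 1) ^ k / k.factorial) := by
          rw [mul_div_right_comm, mul_pow]
          ring
      _ ≤ M * (2 / R) ^ k * (Real.exp 1 ^ k * Real.exp 1) := by gcongr
      _ = M * Real.exp 1 * (2 * Real.exp 1 / R) ^ k := by
          rw [mul_div_right_comm, mul_pow]
          ring
  · have he : (1 : ℝ) ≤ Real.exp 1 := Real.one_le_exp zero_le_one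
    have hhR : 2 * ‖h‖ < R := by
      rw [div_mul_eq_mul_div, div_lt_one hR] at hh
      nlinarith [norm_nonneg h]
    have hmaps : ∀ t ∈ ball (0 : ℂ) 2, x + t • h ∈ ball x R := fun t ht ↦ by
      rw [mem_ball_zero_iff] at ht
      rw [mem_ball, dist_eq_norm, add_sub_cancel_left, norm_smul]
      nlinarith [norm_nonneg h]
    have hφ : DifferentiableOn ℂ (fun t : ℂ ↦ f (x + t • h)) (ball 0 2) :=
      hf.comp (by fun_prop) hmaps
    have hsum := Complex.hasSum_taylorSeries_on_ball hφ (z := 1) (by simp)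
    simp only [sub_zero, one_pow, one_smul] at hsum
    convert hsum using 2 with k
    rw [iteratedDeriv_comp_add_smul hf isOpen_ball x h k (hmaps 0 (by simp))]
    simp

end Holomorphic

section LinearAlgebra

theorem Submodule.finrank_finset_sup_le_sum {𝕜 V ι : Type*} [Field 𝕜] [AddCommGroup V] [Module 𝕜 V]
    (s : Finset ι) (S : ι → Submodule 𝕜 V) (hS : ∀ i, FiniteDimensional 𝕜 (S i)) :
    Module.finrank 𝕜 (s.sup S : Submodule 𝕜 V) ≤ ∑ i ∈ s, Module.finrank 𝕜 (S i) := by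
  classical
  induction s using Finset.induction_on with
  | empty => simp
  | insert i s hi ih =>
    rw [Finset.sup_insert, Finset.sum_insert hi]
    have : FiniteDimensional 𝕜 (s.sup S : Submodule 𝕜 V) :=
      Submodule.finiteDimensional_finset_sup s S
    exact (Submodule.finrank_add_le_finrank_add_finrank _ _).trans (by gcongr)

/-- The values of a multilinear map on a product of finite-dimensional subspaces lie in a subspace
whose dimension is at most the product of the dimensions. -/
theorem MultilinearMap.exists_finiteDimensional_forall_mem {𝕜 E F ι : Type*} [Field 𝕜]
    [AddCommGroup E] [Module 𝕜 E] [AddCommGroup F] [Module 𝕜 F] [Fintype ι]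
    (f : MultilinearMap 𝕜 (fun _ : ι ↦ E) F) (W : ι → Submodule 𝕜 E)
    (hW : ∀ i, FiniteDimensional 𝕜 (W i)) :
    ∃ S : Submodule 𝕜 F, FiniteDimensional 𝕜 S ∧
      Module.finrank 𝕜 S ≤ ∏ i, Module.finrank 𝕜 (W i) ∧
      ∀ v : ι → E, (∀ i, v i ∈ W i) → f v ∈ S := by
  classical
  let b := fun i ↦ Module.finBasis 𝕜 (W i)
  let g : (∀ i, Fin (Module.finrank 𝕜 (W i))) → F := fun σ ↦ f fun i ↦ (b i (σ i) : E)
  refine ⟨Submodule.span 𝕜 (Set.range g), .span_of_finite 𝕜 (Set.finite_range g), ?_,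
    fun v hv ↦ ?_⟩
  · refine (finrank_range_le_card g).trans_eq ?_
    simp
  · have hsum : ∀ i, v i = ∑ j, (b i).repr ⟨v i, hv i⟩ j • (b i j : E) := fun i ↦ by
      have := congrArg Subtype.val ((b i).sum_repr ⟨v i, hv i⟩)
      simpa only [AddSubmonoidClass.coe_finsetSum, SetLike.val_smul] using this.symm
    have hv' : v = fun i ↦ ∑ j, (b i).repr ⟨v i, hv i⟩ j • (b i j : E) := funext hsum
    rw [hv', MultilinearMap.map_sum]
    refine Submodule.sum_mem _ fun σ _ ↦ ?_
    rw [f.map_smul_univ (fun i ↦ (b i).repr ⟨v i, hv i⟩ (σ i)) fun i ↦ (b i (σ i) : E)]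
    exact Submodule.smul_mem _ _ (Submodule.subset_span ⟨σ, rfl⟩)

/-- A subspace of dimension at most `n` is contained in one of dimension exactly `n`, as soon as
there is some subspace of dimension `n`. -/
theorem Submodule.exists_le_finrank_eq {𝕜 V : Type*} [Field 𝕜] [AddCommGroup V] [Module 𝕜 V]
    (S T : Submodule 𝕜 V) [FiniteDimensional 𝕜 S] [FiniteDimensional 𝕜 T]
    (h : Module.finrank 𝕜 S ≤ Module.finrank 𝕜 T) :
    ∃ U : Submodule 𝕜 V, S ≤ U ∧ FiniteDimensional 𝕜 U ∧
      Module.finrank 𝕜 U = Module.finrank 𝕜 T := by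
  obtain ⟨m, hm⟩ := Nat.exists_eq_add_of_le h
  induction m generalizing S with
  | zero => exact ⟨S, le_rfl, ‹_›, by omega⟩
  | succ m ih =>
    obtain ⟨x, hxT, hxS⟩ : ∃ x ∈ T, x ∉ S := by
      by_contra! hcon
      have := Submodule.finrank_mono (show T ≤ S from hcon)
      omega
    have hx0 : x ≠ 0 := fun hx ↦ hxS (hx ▸ S.zero_mem)
    have hfin : FiniteDimensional 𝕜 (S ⊔ Submodule.span 𝕜 {x} : Submodule 𝕜 V) := inferInstance
    have hle : Module.finrank 𝕜 (S ⊔ Submodule.span 𝕜 {x} : Submodule 𝕜 V) ≤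
        Module.finrank 𝕜 S + 1 :=
      (Submodule.finrank_add_le_finrank_add_finrank _ _).trans
        (by rw [finrank_span_singleton hx0])
    have hlt : Module.finrank 𝕜 S < Module.finrank 𝕜 (S ⊔ Submodule.span 𝕜 {x} : Submodule 𝕜 V) :=
      Submodule.finrank_lt_finrank_of_lt (lt_of_le_of_ne le_sup_left fun heq ↦ hxS
        (heq ▸ Submodule.mem_sup_right (Submodule.mem_span_singleton_self x)))
    obtain ⟨U, hU, hU'⟩ := ih (S ⊔ Submodule.span 𝕜 {x}) (by omega) (by omega)
    exact ⟨U, le_sup_left.trans hU, hU'⟩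

theorem exists_submodule_finrank_eq_or_finrank_lt (𝕜 V : Type*) [Field 𝕜] [AddCommGroup V]
    [Module 𝕜 V] (n : ℕ) :
    (∃ Y : Submodule 𝕜 V, FiniteDimensional 𝕜 Y ∧ Module.finrank 𝕜 Y = n) ∨
      FiniteDimensional 𝕜 V ∧ Module.finrank 𝕜 V < n := by
  rcases le_or_gt (n : Cardinal) (Module.rank 𝕜 V) with h | h
  · obtain ⟨s, hs, hli⟩ := Module.le_rank_iff_exists_finset.1 h
    exact .inl ⟨Submodule.span 𝕜 s, .span_finset 𝕜 s, by rw [finrank_span_set_eq_card hli]; simpa⟩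
  · have : FiniteDimensional 𝕜 V :=
      Module.rank_lt_aleph0_iff.1 (h.trans Cardinal.natCast_lt_aleph0)
    refine .inr ⟨this, ?_⟩
    rw [← Module.finrank_eq_rank] at h
    exact_mod_cast h

end LinearAlgebra

section Approximation

variable {E F : Type*} [NormedAddCommGroup E] [NormedSpace ℂ E]
  [NormedAddCommGroup F] [NormedSpace ℂ F]

/-- Approximation of a sum of homogeneous polynomials on sums `∑ l, h l`, where `h l` lies in a
given finite-dimensional subspace for all but the last index `l`. -/
theorem exists_submodule_infDist_le_of_multilinear {a B T γ q : ℝ} (ha : 0 < a) (hB : 0 ≤ B)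
    (hT : 0 < T) (hγ : 0 ≤ γ) (hq : 0 ≤ q)
    (p : ∀ k : ℕ, ContinuousMultilinearMap ℂ (fun _ : Fin k ↦ E) F)
    (hp : ∀ k, ‖p k‖ ≤ B * a ^ k) {J : ℕ} (W : ℕ → Submodule ℂ E)
    (hW : ∀ l, FiniteDimensional ℂ (W l)) (d e : ℕ → ℝ) (hd : ∀ l, 2 ≤ d l)
    (hWd : ∀ l, (Module.finrank ℂ (W l) : ℝ) ≤ d l) (he : ∀ l, 0 ≤ e l) (hdJ : T < d J)
    (hsum_e : ∑ l : Fin (J + 1), a * e l * d l ^ γ ≤ 1 / 2)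
    (hsum_d : ∑ l : Fin (J + 1), d l ^ (1 - q) ≤ 1 / 2) :
    ∃ Y : Submodule ℂ F, FiniteDimensional ℂ Y ∧ (Module.finrank ℂ Y : ℝ) ≤ 2 * T ^ q ∧
      ∀ (h : ℕ → E) (y : F), (∀ l < J, h l ∈ W l) → (∀ l, ‖h l‖ ≤ e l) →
        HasSum (fun k ↦ p k fun _ ↦ ∑ l : Fin (J + 1), h l) y →
        infDist y (Y : Set F) ≤ 2 * B * T ^ (-γ) := by
  classical
  have hd0 : ∀ l, 0 < d l := fun l ↦ by linarith [hd l]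
  choose S hSfin hSrank hSmem using fun (k : ℕ) (τ : Fin k → Fin (J + 1)) ↦
    (p k).toMultilinearMap.exists_finiteDimensional_forall_mem (fun i ↦ W (τ i)) (fun i ↦ hW _)
  let D : ∀ k : ℕ, (Fin k → Fin (J + 1)) → ℝ := fun k τ ↦ ∏ i, d (τ i)
  have hD0 : ∀ k τ, 0 < D k τ := fun k τ ↦ Finset.prod_pos fun i _ ↦ hd0 _
  obtain ⟨N, hN⟩ := pow_unbounded_of_one_lt T one_lt_two
  have hDN : ∀ k τ, D k τ ≤ T → k < N := by
    intro k τ hk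
    by_contra! hNk
    have h2 : (2 : ℝ) ^ k ≤ D k τ := by
      calc (2 : ℝ) ^ k = ∏ _i : Fin k, (2 : ℝ) := by simp
        _ ≤ D k τ := Finset.prod_le_prod (fun _ _ ↦ by norm_num) fun i _ ↦ hd _
    linarith [pow_le_pow_right₀ (one_le_two (α := ℝ)) hNk]
  have hDJ : ∀ k τ, D k τ ≤ T → ∀ i, (τ i : ℕ) < J := by
    intro k τ hk i
    by_contra! hi
    have hiJ : (τ i : ℕ) = J := by have := (τ i).2; omega
    have hone : (1 : ℝ) ≤ ∏ j ∈ Finset.univ.erase i, d (τ j) :=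
      Finset.one_le_prod fun j _ ↦ by linarith [hd (τ j)]
    have hmul : d (τ i) * ∏ j ∈ Finset.univ.erase i, d (τ j) = D k τ :=
      Finset.mul_prod_erase _ (fun i ↦ d (τ i)) (Finset.mem_univ i)
    rw [hiJ] at hmul
    nlinarith [hd0 J]
  let I : Finset (Σ k : ℕ, Fin k → Fin (J + 1)) :=
    (Finset.range N).sigma fun k ↦ Finset.univ.filter fun τ ↦ D k τ ≤ T
  let Y : Submodule ℂ F := I.sup fun x ↦ S x.1 x.2
  have hgeom : HasSum (fun k : ℕ ↦ ((1 : ℝ) / 2) ^ k) 2 := hasSum_geometric_two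
  refine ⟨Y, Submodule.finiteDimensional_finset_sup _ _, ?_, ?_⟩
  · calc (Module.finrank ℂ Y : ℝ)
        ≤ ((∑ x ∈ I, Module.finrank ℂ (S x.1 x.2) : ℕ) : ℝ) := by
          exact_mod_cast Submodule.finrank_finset_sup_le_sum I _ fun x ↦ hSfin x.1 x.2
      _ ≤ ∑ x ∈ I, T ^ q * ∏ i, d (x.2 i) ^ (1 - q) := by
          push_cast
          refine Finset.sum_le_sum fun x hx ↦ ?_
          have hxT : D x.1 x.2 ≤ T := by
            simp only [I, Finset.mem_sigma, Finset.mem_filter] at hx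
            exact hx.2.2
          calc (Module.finrank ℂ (S x.1 x.2) : ℝ)
              ≤ ((∏ i, Module.finrank ℂ (W (x.2 i)) : ℕ) : ℝ) := by exact_mod_cast hSrank x.1 x.2
            _ ≤ D x.1 x.2 := by
                push_cast
                exact Finset.prod_le_prod (fun _ _ ↦ Nat.cast_nonneg _) fun i _ ↦ hWd _
            _ = D x.1 x.2 ^ q * D x.1 x.2 ^ (1 - q) := by
                rw [← Real.rpow_add (hD0 _ _)]
                simp
            _ ≤ T ^ q * D x.1 x.2 ^ (1 - q) := by
                have := (hD0 x.1 x.2).le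
                gcongr
            _ = _ := by
                simp only [D]
                rw [Real.finsetProd_rpow _ _ fun i _ ↦ (hd0 _).le]
      _ = T ^ q * ∑ k ∈ Finset.range N, ∑ τ ∈ Finset.univ.filter (fun τ ↦ D k τ ≤ T),
            ∏ i, d (τ i) ^ (1 - q) := by
          rw [← Finset.mul_sum, Finset.sum_sigma]
      _ ≤ T ^ q * ∑ k ∈ Finset.range N, ((1 : ℝ) / 2) ^ k := by
          gcongr with k _
          calc _ ≤ ∑ τ : Fin k → Fin (J + 1), ∏ i, d (τ i) ^ (1 - q) :=
                Finset.sum_le_sum_of_subset_of_nonneg (Finset.filter_subset _ _) fun τ _ _ ↦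
                  Finset.prod_nonneg fun i _ ↦ Real.rpow_nonneg (hd0 _).le _
            _ = (∑ l : Fin (J + 1), d l ^ (1 - q)) ^ k :=
                (Fintype.sum_pow (fun l : Fin (J + 1) ↦ d l ^ (1 - q)) k).symm
            _ ≤ _ := pow_le_pow_left₀
                (Finset.sum_nonneg fun l _ ↦ Real.rpow_nonneg (hd0 _).le _) hsum_d k
      _ ≤ T ^ q * 2 := by
          gcongr
          exact sum_le_hasSum _ (fun _ _ ↦ by positivity) hgeom
      _ = 2 * T ^ q := mul_comm _ _
  · intro h y hW' he' hy
    let z : ℕ → F := fun k ↦ ∑ τ : Fin k → Fin (J + 1),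
      if D k τ ≤ T then p k (fun i ↦ h (τ i)) else 0
    have hz0 : ∀ k ∉ Finset.range N, z k = 0 := fun k hk ↦
      Finset.sum_eq_zero fun τ _ ↦ if_neg fun hDτ ↦ hk (Finset.mem_range.2 (hDN k τ hDτ))
    have hzY : ∑ k ∈ Finset.range N, z k ∈ Y := by
      refine Submodule.sum_mem _ fun k hk ↦ Submodule.sum_mem _ fun τ _ ↦ ?_
      split_ifs with hDτ
      · have hmem : (⟨k, τ⟩ : Σ k : ℕ, Fin k → Fin (J + 1)) ∈ I := by
          simp only [I, Finset.mem_sigma, Finset.mem_filter, Finset.mem_univ, true_and]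
          exact ⟨hk, hDτ⟩
        exact Finset.le_sup (f := fun x : Σ k : ℕ, Fin k → Fin (J + 1) ↦ S x.1 x.2) hmem
          (hSmem k τ (fun i ↦ h (τ i)) fun i ↦ hW' _ (hDJ k τ hDτ i))
      · exact Submodule.zero_mem _
    refine (infDist_le_dist_of_mem hzY).trans ?_
    rw [dist_eq_norm]
    have hgeom' := hgeom.mul_left (B * T ^ (-γ))
    rw [show 2 * B * T ^ (-γ) = B * T ^ (-γ) * 2 by ring]
    refine (hy.sub (hasSum_sum_of_ne_finset_zero hz0)).norm_le_of_bounded hgeom' fun k ↦ ?_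
    have hexpand : (p k fun _ ↦ ∑ l : Fin (J + 1), h l) =
        ∑ τ : Fin k → Fin (J + 1), p k fun i ↦ h (τ i) :=
      (p k).map_sum fun _ (l : Fin (J + 1)) ↦ h l
    rw [hexpand, ← Finset.sum_sub_distrib]
    calc ‖∑ τ : Fin k → Fin (J + 1),
            ((p k fun i ↦ h (τ i)) - if D k τ ≤ T then p k (fun i ↦ h (τ i)) else 0)‖
        ≤ ∑ τ : Fin k → Fin (J + 1), B * T ^ (-γ) * ∏ i, (a * e (τ i) * d (τ i) ^ γ) := by
          refine norm_sum_le_of_le _ fun τ _ ↦ ?_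
          have hnn : 0 ≤ ∏ i, (a * e (τ i) * d (τ i) ^ γ) := Finset.prod_nonneg fun i _ ↦
            mul_nonneg (mul_nonneg ha.le (he _)) (Real.rpow_nonneg (hd0 _).le _)
          split_ifs with hDτ
          · rw [sub_self, norm_zero]
            positivity
          · rw [sub_zero]
            have hTD : T ^ γ ≤ D k τ ^ γ := by gcongr; exact (not_le.1 hDτ).le
            calc ‖p k fun i ↦ h (τ i)‖ ≤ ‖p k‖ * ∏ i, ‖h (τ i)‖ := (p k).le_opNorm _
              _ ≤ B * a ^ k * ∏ i, e (τ i) := by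
                  gcongr
                  · exact hp k
                  · exact he' _
              _ = B * ((∏ i, a * e (τ i)) * 1) := by
                  rw [Finset.prod_mul_distrib]
                  simp
                  ring
              _ ≤ B * ((∏ i, a * e (τ i)) * (T ^ (-γ) * D k τ ^ γ)) := by
                  have : 0 ≤ ∏ i, a * e (τ i) :=
                    Finset.prod_nonneg fun i _ ↦ mul_nonneg ha.le (he _)
                  gcongr
                  rw [Real.rpow_neg hT.le, ← div_eq_inv_mul, one_le_div (by positivity)]
                  exact hTD
              _ = _ := by
                  rw [Finset.prod_mul_distrib (f := fun i ↦ a * e (τ i)),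
                    Real.finsetProd_rpow _ _ fun i _ ↦ (hd0 _).le]
                  ring
      _ = B * T ^ (-γ) * (∑ l : Fin (J + 1), a * e l * d l ^ γ) ^ k := by
          rw [← Finset.mul_sum, Fintype.sum_pow]
      _ ≤ B * T ^ (-γ) * (1 / 2) ^ k := by
          have : 0 ≤ ∑ l : Fin (J + 1), a * e l * d l ^ γ := Finset.sum_nonneg fun l _ ↦
            mul_nonneg (mul_nonneg ha.le (he _)) (Real.rpow_nonneg (hd0 _).le _)
          gcongr

end Approximation

section Widths

variable {E F G : Type*} [NormedAddCommGroup E] [NormedSpace ℂ E]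
  [NormedAddCommGroup F] [NormedSpace ℂ F] [NormedAddCommGroup G] [NormedSpace ℂ G]

theorem eventually_forall_sum_geometric_le_half {c θ : ℝ} (hc : 0 ≤ c) (hθ0 : 0 ≤ θ)
    (hθ : θ < 1) : ∀ᶠ L : ℕ in atTop, ∀ N : ℕ, ∑ l : Fin N, c * θ ^ (L + (l : ℕ)) ≤ 1 / 2 := by
  have hlim : Tendsto (fun L : ℕ ↦ c * θ ^ L * (1 - θ)⁻¹) atTop (𝓝 0) := by
    simpa using ((tendsto_pow_atTop_nhds_zero_of_lt_one hθ0 hθ).const_mul c).mul_const (1 - θ)⁻¹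
  filter_upwards [hlim.eventually_le_const (show (0 : ℝ) < 1 / 2 by norm_num)] with L hL N
  refine le_trans ?_ hL
  rw [Fin.sum_univ_eq_sum_range fun l ↦ c * θ ^ (L + l)]
  simp only [pow_add, ← mul_assoc]
  rw [← Finset.mul_sum]
  gcongr
  exact sum_le_hasSum _ (fun _ _ ↦ by positivity) (hasSum_geometric_of_lt_one hθ0 hθ)

/-- Near-optimal subspaces extracted from a polynomial bound on the Kolmogorov widths. -/
theorem exists_submodule_norm_sub_le_of_widths {K : Set E} (hK : Bornology.IsBounded K)
    {α C₀ : ℝ} (hC₀ : 0 < C₀) {n : ℕ} (hn : 0 < n)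
    (hd : sInf {s : ℝ | ∃ Y : Submodule ℂ E, FiniteDimensional ℂ Y ∧
          Module.finrank ℂ Y = n ∧ s = ⨆ z : K, infDist (z : E) (Y : Set E)} ≤
        C₀ * (n : ℝ) ^ (-α)) :
    ∃ Y : Submodule ℂ E, FiniteDimensional ℂ Y ∧ Module.finrank ℂ Y ≤ n ∧
      ∀ x ∈ K, ∃ y ∈ Y, ‖x - y‖ ≤ 2 * C₀ * (n : ℝ) ^ (-α) := by
  have hn' : (0 : ℝ) < n := by exact_mod_cast hn
  have hpos : 0 < C₀ * (n : ℝ) ^ (-α) := by positivity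
  rcases exists_submodule_finrank_eq_or_finrank_lt ℂ E n with ⟨Y₀, hY₀, hY₀n⟩ | ⟨hfin, hlt⟩
  · have hlt := hd.trans_lt (show C₀ * (n : ℝ) ^ (-α) < 2 * C₀ * (n : ℝ) ^ (-α) by linarith)
    obtain ⟨_, ⟨Y, hY, hYn, rfl⟩, hlt⟩ :=
      (csInf_lt_iff ⟨0, by
        rintro _ ⟨_, _, _, rfl⟩
        exact Real.iSup_nonneg fun _ ↦ infDist_nonneg⟩ (by exact ⟨_, Y₀, hY₀, hY₀n, rfl⟩)).1 hlt
    refine ⟨Y, hY, hYn.le, fun x hx ↦ ?_⟩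
    obtain ⟨R, hR⟩ := hK.exists_norm_le
    have hbdd : BddAbove (Set.range fun z : K ↦ infDist (z : E) (Y : Set E)) := by
      refine ⟨R, ?_⟩
      rintro _ ⟨z, rfl⟩
      exact (infDist_le_dist_of_mem Y.zero_mem).trans (by simpa using hR z z.2)
    obtain ⟨y, hy, hxy⟩ := (infDist_lt_iff ⟨0, Y.zero_mem⟩).1
      ((le_ciSup hbdd ⟨x, hx⟩).trans_lt hlt)
    exact ⟨y, hy, by rw [← dist_eq_norm]; exact hxy.le⟩
  · exact ⟨⊤, inferInstance, by rw [finrank_top]; exact hlt.le, fun x _ ↦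
      ⟨x, Submodule.mem_top, by rw [sub_self, norm_zero]; linarith⟩⟩

/-- Local form of the width estimate around a point at which the map is analytic. -/
theorem exists_local_approximation_of_hasSum {K : Set E} {f : E → F} {x₀ : E} (hx₀ : x₀ ∈ K)
    {α C : ℝ} (hC : 0 < C) (hα : 0 < α) (Y : ℕ → Submodule ℂ E)
    (hY : ∀ l, FiniteDimensional ℂ (Y l)) (hYl : ∀ l, Module.finrank ℂ (Y l) ≤ 2 ^ l)
    (hYK : ∀ l, ∀ x ∈ K, ∃ y ∈ Y l, ‖x - y‖ ≤ C * ((2 : ℝ) ^ (-α)) ^ l)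
    {a B : ℝ} (ha : 0 < a) (hB : 0 ≤ B)
    (p : ∀ k : ℕ, ContinuousMultilinearMap ℂ (fun _ : Fin k ↦ E) F)
    (hp : ∀ k, ‖p k‖ ≤ B * a ^ k)
    (hf : ∀ h : E, a * ‖h‖ < 1 → HasSum (fun k ↦ p k fun _ ↦ h) (f (x₀ + h)))
    {γ q : ℝ} (hγ : 0 ≤ γ) (hγα : γ < α) (hq : 1 < q) :
    ∃ δ > 0, ∀ T > 0, ∃ Z : Submodule ℂ F, FiniteDimensional ℂ Z ∧
      (Module.finrank ℂ Z : ℝ) ≤ 2 * T ^ q ∧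
      ∀ x ∈ K, ‖x - x₀‖ < δ → infDist (f x) (Z : Set F) ≤ 2 * B * T ^ (-γ) := by
  set κ : ℝ := (2 : ℝ) ^ (-α) with hκ
  have hκ0 : 0 < κ := by positivity
  have hκ1 : κ < 1 := Real.rpow_lt_one_of_one_lt_of_neg one_lt_two (by linarith)
  have hθ1 : κ * 2 ^ γ < 1 := by
    rw [hκ, ← Real.rpow_add two_pos]
    exact Real.rpow_lt_one_of_one_lt_of_neg one_lt_two (by linarith)
  have hθ2 : (2 : ℝ) ^ (1 - q) < 1 := Real.rpow_lt_one_of_one_lt_of_neg one_lt_two (by linarith)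
  obtain ⟨L, hL1, hL2⟩ := ((eventually_forall_sum_geometric_le_half
    (c := a * (4 * C / κ) * 2 ^ γ) (θ := κ * 2 ^ γ) (by positivity) (by positivity) hθ1).and
    (eventually_forall_sum_geometric_le_half (c := (2 : ℝ) ^ (1 - q)) (θ := (2 : ℝ) ^ (1 - q))
      (by positivity) (by positivity) hθ2)).exists
  let ε : ℕ → ℝ := fun l ↦ 2 * C / κ * κ ^ (L + l)
  have hε0 : ∀ l, 0 < ε l := fun l ↦ by positivity
  have hεanti : ∀ l, ε (l + 1) ≤ ε l := fun l ↦ by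
    have : κ ^ (L + (l + 1)) ≤ κ ^ (L + l) := pow_le_pow_of_le_one hκ0.le hκ1.le (by omega)
    simp only [ε]
    gcongr
  let d : ℕ → ℝ := fun l ↦ 2 ^ (L + l + 1)
  let e : ℕ → ℝ := fun l ↦ 2 * ε l
  have hdpow : ∀ (l : ℕ) (s : ℝ), d l ^ s = 2 ^ s * ((2 : ℝ) ^ s) ^ (L + l) := fun l s ↦ by
    simp only [d]
    rw [← Real.rpow_natCast, ← Real.rpow_mul two_pos.le, ← Real.rpow_natCast,
      ← Real.rpow_mul two_pos.le, ← Real.rpow_add two_pos]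
    push_cast
    ring_nf
  have hterm : ∀ l : ℕ, a * e l * d l ^ γ = a * (4 * C / κ) * 2 ^ γ * (κ * 2 ^ γ) ^ (L + l) := by
    intro l
    rw [hdpow, mul_pow]
    simp only [e, ε]
    ring
  have hd2 : ∀ l, 2 ≤ d l := fun l ↦ by
    calc (2 : ℝ) = 2 ^ 1 := by norm_num
      _ ≤ 2 ^ (L + l + 1) := pow_le_pow_right₀ one_le_two (by omega)
  have hae : a * e 0 ≤ 1 / 2 := by
    have h1 := hL1 1
    rw [Fin.sum_univ_one, ← hterm] at h1
    have h2 : 1 ≤ d 0 ^ γ := Real.one_le_rpow (by linarith [hd2 0]) hγ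
    have h3 : 0 ≤ a * e 0 := by positivity
    exact (le_mul_of_one_le_right h3 h2).trans h1
  refine ⟨ε 0, hε0 0, fun T hT ↦ ?_⟩
  obtain ⟨J, hJ⟩ := pow_unbounded_of_one_lt T (one_lt_two (α := ℝ))
  have hdJ : T < d J := hJ.trans_le (pow_le_pow_right₀ one_le_two (by omega))
  let W : ℕ → Submodule ℂ E := fun l ↦ Y (L + l) ⊔ Y (L + l - 1)
  obtain ⟨Z, hZ, hZr, hZd⟩ := exists_submodule_infDist_le_of_multilinear (J := J) ha hB hT hγ
    (by linarith : (0 : ℝ) ≤ q) p hp W (fun l ↦ inferInstance) d e hd2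
    (fun l ↦ by
      have h1 : Module.finrank ℂ (W l) ≤ 2 ^ (L + l) + 2 ^ (L + l - 1) :=
        (Submodule.finrank_add_le_finrank_add_finrank _ _).trans (add_le_add (hYl _) (hYl _))
      have h2 : 2 ^ (L + l - 1) ≤ 2 ^ (L + l) := Nat.pow_le_pow_right two_pos (by omega)
      have h3 : Module.finrank ℂ (W l) ≤ 2 ^ (L + l + 1) := by
        rw [pow_succ]
        omega
      simp only [d]
      exact_mod_cast h3)
    (fun l ↦ by positivity) hdJ
    (by simpa only [hterm] using hL1 (J + 1)) (by simpa only [hdpow] using hL2 (J + 1))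
  refine ⟨Z, hZ, hZr, fun x hx hxx₀ ↦ ?_⟩
  choose P hPmem hP using hYK
  let Q : ℕ → E := fun l ↦ match l with
    | 0 => 0
    | m + 1 => if m < J then P (L + m) x hx - P (L + m) x₀ hx₀ else x - x₀
  have hQε : ∀ l, ‖Q l - (x - x₀)‖ ≤ ε l := by
    intro l
    rcases l with _ | m
    · simpa [Q, norm_sub_rev] using hxx₀.le
    · simp only [Q]
      split_ifs
      · have hε : ε (m + 1) = C * κ ^ (L + m) + C * κ ^ (L + m) := by
          simp only [ε]
          field_simp
          ring
        calc ‖P (L + m) x hx - P (L + m) x₀ hx₀ - (x - x₀)‖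
            = ‖(x₀ - P (L + m) x₀ hx₀) - (x - P (L + m) x hx)‖ := by congr 1; abel
          _ ≤ _ := norm_sub_le _ _
          _ ≤ ε (m + 1) := by
              rw [hε]
              exact add_le_add (hP _ _ _) (hP _ _ _)
      · simpa using (hε0 _).le
  have hQsum : ∑ l : Fin (J + 1), (Q (l + 1) - Q l) = x - x₀ := by
    rw [Fin.sum_univ_eq_sum_range fun l ↦ Q (l + 1) - Q l, Finset.sum_range_sub]
    simp [Q]
  refine hZd (fun l ↦ Q (l + 1) - Q l) (f x) (fun l hl ↦ ?_) (fun l ↦ ?_) ?_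
  · have h1 : Q (l + 1) ∈ W l := by
      simp only [Q, if_pos hl]
      exact Submodule.mem_sup_left (Submodule.sub_mem _ (hPmem _ _ _) (hPmem _ _ _))
    have h2 : Q l ∈ W l := by
      rcases l with _ | m
      · exact Submodule.zero_mem _
      · simp only [Q, if_pos (show m < J by omega)]
        exact Submodule.mem_sup_right (Submodule.sub_mem _ (hPmem _ _ _) (hPmem _ _ _))
    exact Submodule.sub_mem _ h1 h2
  · calc ‖Q (l + 1) - Q l‖ = ‖(Q (l + 1) - (x - x₀)) - (Q l - (x - x₀))‖ := by congr 1; abel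
      _ ≤ ε (l + 1) + ε l := (norm_sub_le (Q (l + 1) - (x - x₀)) (Q l - (x - x₀))).trans
          (add_le_add (hQε (l + 1)) (hQε l))
      _ ≤ e l := by
          simp only [e]
          linarith [hεanti l]
  · rw [hQsum]
    have := hf (x - x₀) (by
      have h1 : a * ‖x - x₀‖ ≤ a * e 0 := by
        have : ‖x - x₀‖ ≤ e 0 := by
          simp only [e]
          linarith [hε0 0]
        gcongr
      linarith)
    rwa [add_sub_cancel] at this

/-- Finite-dimensional approximation of a bounded set in a space that contains it densely can be
realized by subspaces of the smaller space. -/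
theorem exists_submodule_infDist_le_of_denseRange (ι : F →ₗᵢ[ℂ] G) (hι : DenseRange ι)
    (Z : Submodule ℂ G) [FiniteDimensional ℂ Z] {S : Set F} (hS : Bornology.IsBounded S)
    {ε : ℝ} (hε : 0 < ε) :
    ∃ Y : Submodule ℂ F, FiniteDimensional ℂ Y ∧ Module.finrank ℂ Y ≤ Module.finrank ℂ Z ∧
      ∀ v ∈ S, infDist v (Y : Set F) ≤ infDist (ι v) (Z : Set G) + ε := by
  obtain ⟨M, hM0, hM⟩ := hS.exists_pos_norm_le
  set N := Module.finrank ℂ Z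
  let b : Module.Basis (Fin N) ℂ Z := Module.finBasis ℂ Z
  let c : Z →L[ℂ] (Fin N → ℂ) := b.equivFunL
  set R : ℝ := ‖c‖ * (2 * M + ε) with hR
  have hR0 : 0 ≤ R := by positivity
  set η : ℝ := ε / (2 * (N * R + 1)) with hη
  have hη0 : 0 < η := by positivity
  have hw : ∀ i, ∃ w : F, ‖ι w - b i‖ < η := fun i ↦ by
    obtain ⟨w, hw⟩ := hι.exists_dist_lt (b i : G) hη0
    exact ⟨w, by rwa [dist_comm, dist_eq_norm] at hw⟩
  choose w hw using hw
  refine ⟨Submodule.span ℂ (Set.range w), .span_of_finite ℂ (Set.finite_range w),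
    (finrank_range_le_card w).trans_eq (by simp), fun v hv ↦ ?_⟩
  obtain ⟨y, hyZ, hy⟩ := (infDist_lt_iff (⟨0, Z.zero_mem⟩ : (Z : Set G).Nonempty)).1
    (lt_add_of_pos_right (infDist (ι v) (Z : Set G)) (half_pos hε))
  rw [dist_eq_norm] at hy
  have hvM : ‖ι v‖ ≤ M := by rw [ι.norm_map]; exact hM v hv
  have hyn : ‖y‖ ≤ 2 * M + ε := by
    have h1 : infDist (ι v) (Z : Set G) ≤ ‖ι v‖ := by
      simpa using infDist_le_dist_of_mem (x := ι v) Z.zero_mem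
    have h2 : ‖y‖ ≤ ‖ι v‖ + ‖ι v - y‖ := by
      simpa using norm_sub_le (ι v) (ι v - y)
    linarith
  let y' : Z := ⟨y, hyZ⟩
  have hcoef : ∀ i, ‖c y' i‖ ≤ R := fun i ↦ by
    refine (norm_le_pi_norm (c y') i).trans ((c.le_opNorm y').trans ?_)
    rw [hR]
    gcongr
    exact hyn
  have hysum : y = ∑ i, c y' i • (b i : G) := by
    have := congrArg Subtype.val (b.sum_equivFun y')
    simp only [AddSubmonoidClass.coe_finsetSum, SetLike.val_smul] at this
    exact this.symm
  have hmem : ∑ i, c y' i • w i ∈ Submodule.span ℂ (Set.range w) :=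
    Submodule.sum_mem _ fun i _ ↦ Submodule.smul_mem _ _ (Submodule.subset_span ⟨i, rfl⟩)
  refine (infDist_le_dist_of_mem hmem).trans ?_
  rw [dist_eq_norm, ← ι.norm_map, map_sub, map_sum]
  simp only [map_smul]
  have hdiff : ‖y - ∑ i, c y' i • ι (w i)‖ ≤ ε / 2 := by
    rw [hysum, ← Finset.sum_sub_distrib]
    calc ‖∑ i, (c y' i • (b i : G) - c y' i • ι (w i))‖ ≤ ∑ _i : Fin N, R * η := by
          refine norm_sum_le_of_le _ fun i _ ↦ ?_
          rw [← smul_sub, norm_smul, norm_sub_rev]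
          exact mul_le_mul (hcoef i) (hw i).le (norm_nonneg _) hR0
      _ = N * R * η := by
          simp [mul_assoc]
      _ ≤ ε / 2 := by
          have : 0 ≤ N * R := by positivity
          rw [hη, mul_div_assoc', div_le_div_iff₀ (by positivity) two_pos]
          nlinarith
  calc ‖ι v - ∑ i, c y' i • ι (w i)‖ = ‖(ι v - y) + (y - ∑ i, c y' i • ι (w i))‖ := by
        congr 1; abel
    _ ≤ ‖ι v - y‖ + ‖y - ∑ i, c y' i • ι (w i)‖ := norm_add_le _ _
    _ ≤ infDist (ι v) (Z : Set G) + ε := by linarith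

/-- Global form of the width estimate for holomorphic maps into complete spaces. -/
theorem exists_approximation_of_differentiableOn [CompleteSpace F] {O K : Set E} (hO : IsOpen O)
    {f : E → F} (hf : DifferentiableOn ℂ f O) (hK : IsCompact K) (hKO : K ⊆ O)
    {α C : ℝ} (hC : 0 < C) (hα : 0 < α) (Y : ℕ → Submodule ℂ E)
    (hY : ∀ l, FiniteDimensional ℂ (Y l)) (hYl : ∀ l, Module.finrank ℂ (Y l) ≤ 2 ^ l)
    (hYK : ∀ l, ∀ x ∈ K, ∃ y ∈ Y l, ‖x - y‖ ≤ C * ((2 : ℝ) ^ (-α)) ^ l)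
    {γ q : ℝ} (hγ : 0 ≤ γ) (hγα : γ < α) (hq : 1 < q) :
    ∃ (m : ℕ) (A : ℝ), 0 ≤ A ∧ ∀ T > 0, ∃ Z : Submodule ℂ F, FiniteDimensional ℂ Z ∧
      (Module.finrank ℂ Z : ℝ) ≤ m * T ^ q ∧
      ∀ x ∈ K, infDist (f x) (Z : Set F) ≤ A * T ^ (-γ) := by
  suffices h : ∃ (m : ℕ) (A : ℝ), 0 ≤ A ∧ ∀ T > 0, ∃ Z : Submodule ℂ F, FiniteDimensional ℂ Z ∧
      (Module.finrank ℂ Z : ℝ) ≤ m * T ^ q ∧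
      ∀ x ∈ K ∩ K, infDist (f x) (Z : Set F) ≤ A * T ^ (-γ) by
    simpa only [Set.inter_self] using h
  refine hK.induction_on (p := fun S ↦ ∃ (m : ℕ) (A : ℝ), 0 ≤ A ∧ ∀ T > 0, ∃ Z : Submodule ℂ F,
    FiniteDimensional ℂ Z ∧ (Module.finrank ℂ Z : ℝ) ≤ m * T ^ q ∧
      ∀ x ∈ S ∩ K, infDist (f x) (Z : Set F) ≤ A * T ^ (-γ)) ?_ ?_ ?_ ?_
  · exact ⟨0, 0, le_rfl, fun T _ ↦ ⟨⊥, inferInstance, by simp, by simp⟩⟩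
  · rintro s t hst ⟨m, A, hA, h⟩
    refine ⟨m, A, hA, fun T hT ↦ ?_⟩
    obtain ⟨Z, hZ, hZr, hZd⟩ := h T hT
    exact ⟨Z, hZ, hZr, fun x hx ↦ hZd x ⟨hst hx.1, hx.2⟩⟩
  · rintro s t ⟨m₁, A₁, hA₁, h₁⟩ ⟨m₂, A₂, hA₂, h₂⟩
    refine ⟨m₁ + m₂, max A₁ A₂, le_max_of_le_left hA₁, fun T hT ↦ ?_⟩
    obtain ⟨Z₁, hZ₁, hr₁, hd₁⟩ := h₁ T hT
    obtain ⟨Z₂, hZ₂, hr₂, hd₂⟩ := h₂ T hT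
    refine ⟨Z₁ ⊔ Z₂, inferInstance, ?_, ?_⟩
    · have : (Module.finrank ℂ (Z₁ ⊔ Z₂ : Submodule ℂ F) : ℝ) ≤
          Module.finrank ℂ Z₁ + Module.finrank ℂ Z₂ := by
        exact_mod_cast Submodule.finrank_add_le_finrank_add_finrank Z₁ Z₂
      push_cast
      linarith
    · rintro x ⟨hx | hx, hxK⟩
      · refine (infDist_le_infDist_of_subset (SetLike.coe_subset_coe.2 le_sup_left)
          ⟨0, Z₁.zero_mem⟩).trans ((hd₁ x ⟨hx, hxK⟩).trans ?_)
        gcongr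
        exact le_max_left _ _
      · refine (infDist_le_infDist_of_subset (SetLike.coe_subset_coe.2 le_sup_right)
          ⟨0, Z₂.zero_mem⟩).trans ((hd₂ x ⟨hx, hxK⟩).trans ?_)
        gcongr
        exact le_max_right _ _
  · intro x₀ hx₀
    have hcont := (hf.differentiableAt (hO.mem_nhds (hKO hx₀))).continuousAt
    have hbd : ∀ᶠ y in 𝓝 x₀, ‖f y‖ < ‖f x₀‖ + 1 :=
      hcont.norm.eventually_lt_const (lt_add_one _)
    obtain ⟨R, hR, hRs⟩ := Metric.mem_nhds_iff.1 (inter_mem (hO.mem_nhds (hKO hx₀)) hbd)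
    obtain ⟨a, B, p, ha, hB, hp, hsum⟩ := exists_hasSum_multilinear_of_forall_mem_ball hR
      (hf.mono fun y hy ↦ (hRs hy).1) fun y hy ↦ (hRs hy).2.le
    obtain ⟨δ, hδ, h⟩ := exists_local_approximation_of_hasSum hx₀ hC hα Y hY hYl hYK ha hB p hp
      hsum hγ hγα hq
    refine ⟨ball x₀ δ, mem_nhdsWithin_of_mem_nhds (ball_mem_nhds x₀ hδ), 2, 2 * B, by positivity,
      fun T hT ↦ ?_⟩
    obtain ⟨Z, hZ, hZr, hZd⟩ := h T hT
    exact ⟨Z, hZ, by exact_mod_cast hZr, fun x hx ↦ hZd x hx.2 (by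
      rw [← dist_eq_norm]
      exact hx.1)⟩

end Widths

/-- **Holomorphic maps preserve polynomial decay of Kolmogorov widths** (Cohen–DeVore).
If `u : O → V` is holomorphic and uniformly bounded on an open subset `O` of a complex
Banach space `X`, `K ⊆ O` is compact and `d_n(K) ≤ C₀ n^{−α}` with `α > 1`, then for every
`0 < β < α − 1` there is `C₁ > 0` with `d_n(u(K)) ≤ C₁ n^{−β}`. -/
theorem holomorphic_image_width_decay
    {X V : Type*} [NormedAddCommGroup X] [NormedSpace ℂ X]
    [NormedAddCommGroup V] [NormedSpace ℂ V]
    (O : Set X) (hO : IsOpen O) (u : X → V)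
    (hu : DifferentiableOn ℂ u O)
    (hbdd : ∃ Mb : ℝ, ∀ z ∈ O, ‖u z‖ ≤ Mb)
    (K : Set X) (hK : IsCompact K) (hKO : K ⊆ O)
    (α C₀ : ℝ) (hα : 1 < α) (hC₀ : 0 < C₀)
    (hd : ∀ n : ℕ, 0 < n →
      sInf {s : ℝ | ∃ Y : Submodule ℂ X, FiniteDimensional ℂ Y ∧
          Module.finrank ℂ Y = n ∧ s = ⨆ z : K, infDist (z : X) (Y : Set X)} ≤
        C₀ * (n : ℝ) ^ (-α)) :
    ∀ β : ℝ, 0 < β → β < α - 1 →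
      ∃ C₁ : ℝ, 0 < C₁ ∧ ∀ n : ℕ, 0 < n →
        sInf {s : ℝ | ∃ Y : Submodule ℂ V, FiniteDimensional ℂ Y ∧
            Module.finrank ℂ Y = n ∧ s = ⨆ w : u '' K, infDist (w : V) (Y : Set V)} ≤
          C₁ * (n : ℝ) ^ (-β) := by
  intro β hβ hβα
  have hα0 : 0 < α := by linarith
  have hY : ∀ l : ℕ, ∃ Y : Submodule ℂ X, FiniteDimensional ℂ Y ∧ Module.finrank ℂ Y ≤ 2 ^ l ∧
      ∀ x ∈ K, ∃ y ∈ Y, ‖x - y‖ ≤ 2 * C₀ * ((2 : ℝ) ^ (-α)) ^ l := by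
    intro l
    obtain ⟨Y, hY, hYr, hYK⟩ := exists_submodule_norm_sub_le_of_widths hK.isBounded hC₀
      (pow_pos two_pos l) (hd (2 ^ l) (pow_pos two_pos l))
    refine ⟨Y, hY, hYr, fun x hx ↦ ?_⟩
    obtain ⟨y, hy, hxy⟩ := hYK x hx
    refine ⟨y, hy, hxy.trans_eq ?_⟩
    push_cast
    rw [← Real.rpow_natCast, ← Real.rpow_natCast, ← Real.rpow_mul two_pos.le,
      ← Real.rpow_mul two_pos.le, mul_comm (l : ℝ)]
  choose Y hYfin hYr hYK using hY
  let ι : V →ₗᵢ[ℂ] UniformSpace.Completion V := UniformSpace.Completion.toComplₗᵢ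
  have hι : DenseRange ι := UniformSpace.Completion.denseRange_coe
  have hιu : DifferentiableOn ℂ (fun x ↦ ι (u x)) O :=
    ι.toContinuousLinearMap.differentiable.comp_differentiableOn hu
  have huK : Bornology.IsBounded (u '' K) :=
    (hK.image_of_continuousOn (hu.continuousOn.mono hKO)).isBounded
  set q : ℝ := (α / β + 1) / 2 with hq
  have hαβ : 1 < α / β := by
    rw [lt_div_iff₀ hβ]
    linarith
  have hq1 : 1 < q := by linarith
  have hqβ : q * β < α := by
    have : q * β = (α + β) / 2 := by
      rw [hq]
      field_simp
    linarith
  obtain ⟨m, A, hA, h⟩ := exists_approximation_of_differentiableOn hO hιu hK hKO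
    (by positivity : 0 < 2 * C₀) hα0 Y hYfin hYr hYK (γ := q * β) (by positivity) hqβ hq1
  refine ⟨A * ((m : ℝ) + 1) ^ β + 1, by positivity, fun n hn ↦ ?_⟩
  have hn' : (0 : ℝ) < n := by exact_mod_cast hn
  have hbound : 0 ≤ (A * ((m : ℝ) + 1) ^ β + 1) * (n : ℝ) ^ (-β) := by positivity
  obtain ⟨Z, hZ, hZr, hZd⟩ := h (((n : ℝ) / (m + 1)) ^ q⁻¹) (by positivity)
  rw [← Real.rpow_mul (by positivity), inv_mul_cancel₀ (by linarith), Real.rpow_one] at hZr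
  have hZn : Module.finrank ℂ Z ≤ n := by
    have : (Module.finrank ℂ Z : ℝ) ≤ n := hZr.trans (by
      rw [mul_div_assoc', div_le_iff₀ (by positivity)]
      nlinarith)
    exact_mod_cast this
  obtain ⟨Y', hY', hYr', hYd'⟩ := exists_submodule_infDist_le_of_denseRange ι hι Z huK
    (by positivity : 0 < (n : ℝ) ^ (-β))
  have hrate : A * (((n : ℝ) / (m + 1)) ^ q⁻¹) ^ (-(q * β)) =
      A * ((m : ℝ) + 1) ^ β * (n : ℝ) ^ (-β) := by
    rw [← Real.rpow_mul (by positivity),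
      show q⁻¹ * -(q * β) = -β by field_simp, Real.div_rpow hn'.le (by positivity),
      Real.rpow_neg (by positivity : (0 : ℝ) ≤ m + 1), div_inv_eq_mul]
    ring
  rcases Set.eq_empty_or_nonempty {s : ℝ | ∃ Y : Submodule ℂ V, FiniteDimensional ℂ Y ∧
      Module.finrank ℂ Y = n ∧ s = ⨆ w : u '' K, infDist (w : V) (Y : Set V)} with
    hempty | ⟨_, T, hT, hTn, _⟩
  · rw [hempty, Real.sInf_empty]
    exact hbound
  · obtain ⟨U, hYU, hU, hUn⟩ := Y'.exists_le_finrank_eq T (by omega)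
    have hmem : (⨆ w : u '' K, infDist (w : V) (U : Set V)) ∈
        {s : ℝ | ∃ Y : Submodule ℂ V, FiniteDimensional ℂ Y ∧
          Module.finrank ℂ Y = n ∧ s = ⨆ w : u '' K, infDist (w : V) (Y : Set V)} :=
      ⟨U, hU, hUn.trans hTn, rfl⟩
    refine (csInf_le ⟨0, ?_⟩ hmem).trans (Real.iSup_le ?_ hbound)
    · rintro _ ⟨_, _, _, rfl⟩
      exact Real.iSup_nonneg fun _ ↦ infDist_nonneg
    · rintro ⟨_, x, hx, rfl⟩
      calc infDist (u x) (U : Set V) ≤ infDist (u x) (Y' : Set V) :=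
            infDist_le_infDist_of_subset (SetLike.coe_subset_coe.2 hYU) ⟨0, Y'.zero_mem⟩
        _ ≤ infDist (ι (u x)) (Z : Set (UniformSpace.Completion V)) + (n : ℝ) ^ (-β) :=
            hYd' _ ⟨x, hx, rfl⟩
        _ ≤ A * ((m : ℝ) + 1) ^ β * (n : ℝ) ^ (-β) + (n : ℝ) ^ (-β) := by
            rw [← hrate]
            gcongr
            exact hZd x hx
        _ = _ := by ring
end

section
/- (Arbitrary polynomial decay of greedy approximation rates under analytic parameter dependence.) Let X be a complex Hilbert space, O ⊂ ℂ^d an open set, u : O → X a holomorphic map that is uniformly bounded on O, and 𝒩 ⊂ O a compact set; set K = u(𝒩) ⊂ X. Then for every weak greedy sequence with constant γ ∈ (0,1] for K and for every α > 0 there exists a constant C_α > 0 such that σ_n(K) ≤ C_α n^{−α} for all n ∈ ℕ; equivalently, every element of K can be approximated by elements of the span of the first n greedy snapshots with error at most C_α n^{−α}. -/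
open Metric

/-- Taylor approximation of a bounded holomorphic function on the disc of radius `4`. -/
theorem exists_taylor_approx {X : Type*} [NormedAddCommGroup X] [NormedSpace ℂ X]
    [CompleteSpace X] {g : ℂ → X} {M : ℝ} (hg : DifferentiableOn ℂ g (closedBall 0 4))
    (hM : ∀ z ∈ closedBall (0 : ℂ) 4, ‖g z‖ ≤ M) (n : ℕ) :
    ∃ a : ℕ → X, ∀ z : ℂ, ‖z‖ ≤ 2 →
      ‖g z - ∑ k ∈ Finset.range n, z ^ k • a k‖ ≤ 2 * M * (1 / 2) ^ n := by
  have hps : HasFPowerSeriesOnBall g (cauchyPowerSeries g 0 4) 0 4 := by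
    have := DifferentiableOn.hasFPowerSeriesOnBall (R := 4) (c := 0) (f := g)
      (by simpa using hg) (by norm_num)
    simpa using this
  have hM0 : 0 ≤ M := (norm_nonneg _).trans (hM 0 (by simp))
  have hcoef : ∀ k, ‖cauchyPowerSeries g 0 4 k‖ ≤ M * (1 / 4) ^ k := by
    intro k
    refine (norm_cauchyPowerSeries_le g 0 4 k).trans ?_
    have h1 : ∫ θ : ℝ in (0 : ℝ)..2 * Real.pi, ‖g (circleMap 0 4 θ)‖ ≤ M * (2 * Real.pi) := by
      refine (le_abs_self _).trans ?_
      have := intervalIntegral.norm_integral_le_of_norm_le_const (a := 0) (b := 2 * Real.pi)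
        (f := fun θ : ℝ => ‖g (circleMap 0 4 θ)‖) (C := M) (fun θ _ => by
          rw [norm_norm]
          exact hM _ (circleMap_mem_closedBall 0 (by norm_num) θ))
      rwa [sub_zero, abs_of_pos Real.two_pi_pos] at this
    have h2 : (2 * Real.pi)⁻¹ * ∫ θ : ℝ in (0 : ℝ)..2 * Real.pi, ‖g (circleMap 0 4 θ)‖ ≤ M := by
      rw [inv_mul_le_iff₀ Real.two_pi_pos]
      linarith
    have h3 : |(4 : ℝ)|⁻¹ = 1 / 4 := by norm_num
    rw [h3]
    gcongr
  refine ⟨fun k => (cauchyPowerSeries g 0 4).coeff k, fun z hz => ?_⟩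
  have hsum := hps.hasSum (y := z) (by
    rw [Metric.mem_eball, edist_zero_right]
    have : ‖z‖ < 4 := by linarith
    rw [← ofReal_norm]
    simpa using (ENNReal.ofReal_lt_ofReal_iff (by norm_num : (0 : ℝ) < 4)).2 this)
  have := norm_sub_le_of_geometric_bound_of_hasSum (r := 1 / 2) (C := M) (by norm_num) (fun k => by
    refine ((cauchyPowerSeries g 0 4 k).le_opNorm _).trans ?_
    have h1 : ∏ _i : Fin k, ‖z‖ ≤ 2 ^ k := by
      simpa using pow_le_pow_left₀ (norm_nonneg z) hz k
    calc _ ≤ (M * (1 / 4) ^ k) * 2 ^ k := by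
          gcongr
          exact hcoef k
      _ = M * (1 / 2) ^ k := by
          rw [mul_assoc, ← mul_pow]; norm_num) hsum n
  rw [norm_sub_rev]
  simp only [FormalMultilinearSeries.apply_eq_pow_smul_coeff, zero_add] at this
  refine this.trans (le_of_eq ?_)
  ring

/-- Polynomial interpolation at the `n`-th roots of unity scaled by `2`, with a bound on the
Lebesgue function on the unit disc. -/
theorem exists_interpolation_nodes (n : ℕ) (hn : n ≠ 0) :
    ∃ (ζ : Fin n → ℂ) (l : Fin n → ℂ → ℂ), (∀ j, ‖ζ j‖ = 2) ∧
      ∀ z : ℂ, ‖z‖ ≤ 1 → (∑ j, ‖l j z‖ ≤ 2) ∧ ∀ k < n, ∑ j, l j z * ζ j ^ k = z ^ k := by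
  set ω := Complex.exp (2 * Real.pi * Complex.I / n)
  have hω : IsPrimitiveRoot ω n := Complex.isPrimitiveRoot_exp n hn
  have hω1 : ‖ω‖ = 1 := hω.norm'_eq_one hn
  have hω0 : ω ≠ 0 := hω.ne_zero hn
  have hn0 : (n : ℂ) ≠ 0 := Nat.cast_ne_zero.2 hn
  have hnr : (0 : ℝ) < n := by positivity
  have hζ : ∀ j : Fin n, ‖2 * ω ^ (j : ℕ)‖ = 2 := fun j => by simp [hω1]
  refine ⟨fun j => 2 * ω ^ (j : ℕ),
    fun j z => (n : ℂ)⁻¹ * ∑ m ∈ Finset.range n, (z / (2 * ω ^ (j : ℕ))) ^ m, hζ,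
    fun z hz => ⟨?_, fun k hk => ?_⟩⟩
  · have hb : ∀ j : Fin n,
        ‖(n : ℂ)⁻¹ * ∑ m ∈ Finset.range n, (z / (2 * ω ^ (j : ℕ))) ^ m‖ ≤ (n : ℝ)⁻¹ * 2 := by
      intro j
      rw [norm_mul, norm_inv, Complex.norm_natCast]
      gcongr
      refine (norm_sum_le _ _).trans ?_
      calc ∑ m ∈ Finset.range n, ‖(z / (2 * ω ^ (j : ℕ))) ^ m‖
          ≤ ∑ m ∈ Finset.range n, (1 / 2 : ℝ) ^ m := by
            gcongr with m _
            rw [norm_pow, norm_div, hζ j]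
            gcongr
        _ ≤ 2 := sum_geometric_two_le n
    refine (Finset.sum_le_sum fun j _ => hb j).trans (le_of_eq ?_)
    simp only [Finset.sum_const, Finset.card_univ, Fintype.card_fin, nsmul_eq_mul]
    field_simp
  · have hortho : ∀ m ∈ Finset.range n,
        ∑ j : Fin n, (z / (2 * ω ^ (j : ℕ))) ^ m * (2 * ω ^ (j : ℕ)) ^ k
          = if m = k then n * z ^ k else 0 := by
      intro m hm
      have hm := Finset.mem_range.1 hm
      have hterm : ∀ j : Fin n, (z / (2 * ω ^ (j : ℕ))) ^ m * (2 * ω ^ (j : ℕ)) ^ k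
          = z ^ m * 2 ^ k / 2 ^ m * (ω ^ k / ω ^ m) ^ (j : ℕ) := by
        intro j
        have : ω ^ (j : ℕ) ≠ 0 := pow_ne_zero _ hω0
        rw [div_pow, mul_pow, mul_pow, div_pow, ← pow_mul, ← pow_mul, ← pow_mul, ← pow_mul,
          mul_comm k, mul_comm m]
        field_simp
      simp_rw [hterm]
      rw [← Finset.mul_sum, Fin.sum_univ_eq_sum_range (fun j => (ω ^ k / ω ^ m) ^ j)]
      split_ifs with h
      · subst h
        rw [div_self (pow_ne_zero _ hω0)]
        simp
        ring
      · have hne : ω ^ k / ω ^ m ≠ 1 := by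
          rw [Ne, div_eq_one_iff_eq (pow_ne_zero _ hω0)]
          exact fun e => h (hω.pow_inj hk hm e).symm
        rw [geom_sum_eq hne, div_pow, ← pow_mul, ← pow_mul, mul_comm k, mul_comm m, pow_mul,
          pow_mul, hω.pow_eq_one]
        simp
    simp_rw [mul_assoc, Finset.sum_mul]
    rw [← Finset.mul_sum, Finset.sum_comm, Finset.sum_congr rfl hortho]
    simp [hk, hn0]

/-- A bounded separately holomorphic function on a polydisc of radius `4` is approximated on the
unit polydisc, at a geometric rate, by elements of the span of its values on an `n ^ d` grid. -/
theorem exists_grid_approx {ι : Type*} [Fintype ι] [DecidableEq ι]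
    {X : Type*} [NormedAddCommGroup X] [NormedSpace ℂ X] [CompleteSpace X]
    {F : (ι → ℂ) → X} {M : ℝ}
    (hF : ∀ w : ι → ℂ, (∀ i, ‖w i‖ ≤ 4) → ∀ i,
      DifferentiableOn ℂ (fun t => F (Function.update w i t)) (closedBall 0 4))
    (hM : ∀ w : ι → ℂ, (∀ i, ‖w i‖ ≤ 4) → ‖F w‖ ≤ M) (n : ℕ) (hn : n ≠ 0) :
    ∃ p : (ι → Fin n) → X, ∀ z : ι → ℂ, (∀ i, ‖z i‖ ≤ 1) →
      ∃ w ∈ Submodule.span ℂ (Set.range p),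
        ‖F z - w‖ ≤ (2 ^ Fintype.card ι - 1) * (6 * M * (1 / 2) ^ n) := by
  obtain ⟨ζ, l, hζ, hl⟩ := exists_interpolation_nodes n hn
  refine ⟨fun j => F fun i => ζ (j i), fun z hz => ?_⟩
  suffices H : ∀ s : Finset ι, ∀ z : ι → ℂ, (∀ i ∈ s, ‖z i‖ ≤ 1) →
      (∀ i ∉ s, ∃ j, z i = ζ j) →
      ∃ w ∈ Submodule.span ℂ (Set.range fun j : ι → Fin n => F fun i => ζ (j i)),
        ‖F z - w‖ ≤ (2 ^ s.card - 1) * (6 * M * (1 / 2) ^ n) from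
    H Finset.univ z (fun i _ => hz i) (by simp)
  clear hz z
  intro s
  induction s using Finset.induction_on with
  | empty =>
    intro z _ hz
    choose j hj using fun i => hz i (Finset.notMem_empty i)
    refine ⟨F z, Submodule.subset_span ⟨j, ?_⟩, by simp⟩
    simp only [← hj]
  | insert i s his ih =>
    intro z hz1 hz2
    have hz4 : ∀ i, ‖z i‖ ≤ 4 := by
      intro k
      by_cases hk : k ∈ insert i s
      · linarith [hz1 k hk]
      · obtain ⟨j, hj⟩ := hz2 k hk
        rw [hj, hζ]; norm_num
    have hzi : ‖z i‖ ≤ 1 := hz1 i (by simp)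
    obtain ⟨hl2, hlk⟩ := hl (z i) hzi
    have hnode : ∀ j, ∃ w ∈ Submodule.span ℂ (Set.range fun j : ι → Fin n => F fun i => ζ (j i)),
        ‖F (Function.update z i (ζ j)) - w‖ ≤ (2 ^ s.card - 1) * (6 * M * (1 / 2) ^ n) := by
      intro j
      refine ih _ (fun k hk => ?_) (fun k hk => ?_)
      · rw [Function.update_of_ne (by rintro rfl; exact his hk)]
        exact hz1 k (Finset.mem_insert_of_mem hk)
      · by_cases hki : k = i
        · subst hki
          exact ⟨j, by simp⟩
        · rw [Function.update_of_ne hki]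
          exact hz2 k (by simp [hki, hk])
    choose w hwW hw using hnode
    obtain ⟨a, ha⟩ := exists_taylor_approx (hF z hz4 i) (M := M) (fun t ht => by
      refine hM _ fun k => ?_
      by_cases hki : k = i
      · subst hki
        simpa using ht
      · rw [Function.update_of_ne hki]
        exact hz4 k) n
    have haz := ha (z i) (by linarith)
    rw [Function.update_eq_self] at haz
    refine ⟨∑ j, l j (z i) • w j,
      Submodule.sum_mem _ fun j _ => Submodule.smul_mem _ _ (hwW j), ?_⟩
    set g : ℂ → X := fun t => F (Function.update z i t)
    set P : ℂ → X := fun t => ∑ k ∈ Finset.range n, t ^ k • a k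
    set B : ℝ := M * (1 / 2) ^ n
    have hM0 : 0 ≤ M := (norm_nonneg _).trans (hM z hz4)
    have hB : 0 ≤ B := by positivity
    have hP : P (z i) = ∑ j, l j (z i) • P (ζ j) := by
      simp only [P, Finset.smul_sum, smul_smul]
      rw [Finset.sum_comm]
      refine Finset.sum_congr rfl fun k hk => ?_
      rw [← Finset.sum_smul, hlk k (Finset.mem_range.1 hk)]
    have hdecomp : F z - ∑ j, l j (z i) • w j
        = (F z - P (z i)) + ∑ j, l j (z i) • ((P (ζ j) - g (ζ j)) + (g (ζ j) - w j)) := by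
      simp only [sub_add_sub_cancel, smul_sub, Finset.sum_sub_distrib]
      rw [← hP]
      abel
    have hone : (0 : ℝ) ≤ 2 ^ s.card - 1 := by
      linarith [one_le_pow₀ (M₀ := ℝ) (a := 2) (by norm_num) (n := s.card)]
    have hterm : ∀ j, ‖l j (z i) • ((P (ζ j) - g (ζ j)) + (g (ζ j) - w j))‖
        ≤ ‖l j (z i)‖ * (2 * B + (2 ^ s.card - 1) * (6 * B)) := by
      intro j
      rw [norm_smul]
      gcongr
      refine (norm_add_le _ _).trans (add_le_add ?_ ?_)
      · rw [norm_sub_rev]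
        have := ha (ζ j) (hζ j).le
        simp only [B]
        linarith
      · have := hw j
        simp only [B]
        rwa [← mul_assoc 6]
    have hsum : ‖∑ j, l j (z i) • ((P (ζ j) - g (ζ j)) + (g (ζ j) - w j))‖
        ≤ 2 * (2 * B + (2 ^ s.card - 1) * (6 * B)) := by
      refine (norm_sum_le _ _).trans ((Finset.sum_le_sum fun j _ => hterm j).trans ?_)
      rw [← Finset.sum_mul]
      gcongr
    rw [hdecomp, Finset.card_insert_of_notMem his]
    refine (norm_add_le _ _).trans ((add_le_add haz hsum).trans (le_of_eq ?_))
    simp only [B]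
    ring

section Greedy

variable {X : Type*} [NormedAddCommGroup X] [InnerProductSpace ℂ X]

/-- The distance to a subspace is realised by the orthogonal projection. -/
theorem infDist_eq_norm_sub_starProjection (V : Submodule ℂ X) [V.HasOrthogonalProjection]
    (y : X) : infDist y (V : Set X) = ‖y - V.starProjection y‖ := by
  rw [Submodule.starProjection_minimal, infDist_eq_iInf]
  simp only [dist_eq_norm]
  rfl

/-- The squared projections of an orthonormal family to a subspace sum to at most its dimension. -/
theorem Orthonormal.sum_sq_norm_starProjection_le {ι : Type*} [Fintype ι] {e : ι → X}
    (he : Orthonormal ℂ e) (W : Submodule ℂ X) [FiniteDimensional ℂ W] :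
    ∑ i, ‖W.starProjection (e i)‖ ^ 2 ≤ Module.finrank ℂ W := by
  have key : ∀ v : X, ‖W.starProjection v‖ ^ 2
      = ∑ j, ‖inner ℂ v (stdOrthonormalBasis ℂ W j : X)‖ ^ 2 := by
    intro v
    have h := (stdOrthonormalBasis ℂ W).sum_sq_norm_inner_right (W.orthogonalProjectionOnto v)
    rw [Submodule.starProjection_apply, Submodule.norm_coe, ← h]
    refine Finset.sum_congr rfl fun j _ => ?_
    rw [Submodule.coe_inner, ← Submodule.starProjection_apply,
      ← Submodule.inner_starProjection_left_eq_right,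
      Submodule.starProjection_eq_self_iff.2 (Submodule.coe_mem _), norm_inner_symm]
  simp_rw [key]
  rw [Finset.sum_comm]
  calc _ ≤ ∑ j : Fin (Module.finrank ℂ W), ‖(stdOrthonormalBasis ℂ W j : X)‖ ^ 2 :=
        Finset.sum_le_sum fun j _ => he.sum_inner_products_le _
    _ = Module.finrank ℂ W := by
        simp [Submodule.norm_coe, (stdOrthonormalBasis ℂ W).orthonormal.1]

/-- The worst distance from `K` to the span of the first `n` terms of `x`. -/
noncomputable def spanDeviation (K : Set X) (x : ℕ → X) (n : ℕ) : ℝ :=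
  ⨆ y : K, infDist (y : X) (Submodule.span ℂ (x '' Set.Iio n) : Set X)

variable {K : Set X} {x : ℕ → X} {M : ℝ}

theorem spanDeviation_nonneg (n : ℕ) : 0 ≤ spanDeviation K x n :=
  Real.iSup_nonneg fun _ => infDist_nonneg

theorem infDist_span_le (hM : ∀ y ∈ K, ‖y‖ ≤ M) (n : ℕ) (y : X) (hy : y ∈ K) :
    infDist y (Submodule.span ℂ (x '' Set.Iio n) : Set X) ≤ M :=
  (infDist_le_dist_of_mem (Submodule.zero_mem _)).trans (by simpa using hM y hy)

theorem infDist_le_spanDeviation (hM : ∀ y ∈ K, ‖y‖ ≤ M) (n : ℕ) {y : X} (hy : y ∈ K) :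
    infDist y (Submodule.span ℂ (x '' Set.Iio n) : Set X) ≤ spanDeviation K x n :=
  le_ciSup (f := fun y : K => infDist (y : X) (Submodule.span ℂ (x '' Set.Iio n) : Set X))
    ⟨M, by rintro _ ⟨y, rfl⟩; exact infDist_span_le hM n y y.2⟩ ⟨y, hy⟩

theorem spanDeviation_le (hM : ∀ y ∈ K, ‖y‖ ≤ M) (hM0 : 0 ≤ M) (n : ℕ) :
    spanDeviation K x n ≤ M :=
  Real.iSup_le (fun y => infDist_span_le hM n y y.2) hM0

theorem spanDeviation_antitone (hM : ∀ y ∈ K, ‖y‖ ≤ M) : Antitone (spanDeviation K x) := by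
  intro m n hmn
  refine Real.iSup_le (fun y => ?_) (spanDeviation_nonneg m)
  refine (infDist_le_infDist_of_subset ?_ ⟨0, Submodule.zero_mem _⟩).trans
    (infDist_le_spanDeviation hM m y.2)
  exact Submodule.span_mono (Set.image_mono (Set.Iio_subset_Iio hmn))

/-- If `K` is `ε`-close to a subspace `W`, then `N ≥ 4 γ⁻² dim W` further steps of the weak greedy
algorithm halve the deviation up to an error of size `2 ε / γ`. -/
theorem spanDeviation_add_le (hM : ∀ y ∈ K, ‖y‖ ≤ M) (hxK : ∀ n, x n ∈ K) {γ : ℝ} (hγ0 : 0 < γ)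
    (hγ1 : γ ≤ 1)
    (hgreedy : ∀ n : ℕ, γ * spanDeviation K x n ≤
      infDist (x n) (Submodule.span ℂ (x '' Set.Iio n) : Set X))
    {W : Submodule ℂ X} [FiniteDimensional ℂ W] {ε : ℝ} (hε : 0 ≤ ε)
    (hW : ∀ y ∈ K, ∃ w ∈ W, ‖y - w‖ ≤ ε) (k N : ℕ) (hN : 0 < N)
    (hWN : 4 * (Module.finrank ℂ W : ℝ) ≤ γ ^ 2 * N) :
    spanDeviation K x (k + N) ≤ spanDeviation K x k / 2 + 2 * ε / γ := by
  have hσ0 := spanDeviation_nonneg (K := K) (x := x) k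
  have hfd : ∀ n, FiniteDimensional ℂ (Submodule.span ℂ (x '' Set.Iio n)) := fun n =>
    FiniteDimensional.span_of_finite ℂ ((Set.finite_Iio n).image x)
  set V : ℕ → Submodule ℂ X := fun n => Submodule.span ℂ (x '' Set.Iio n) with hV
  have : ∀ n, FiniteDimensional ℂ (V n) := hfd
  have hVmono : Monotone V := fun m n hmn =>
    Submodule.span_mono (Set.image_mono (Set.Iio_subset_Iio hmn))
  set q : ℕ → X := fun n => x n - (V n).starProjection (x n) with hq
  have hqnorm : ∀ n, infDist (x n) (V n : Set X) = ‖q n‖ := fun n =>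
    infDist_eq_norm_sub_starProjection _ _
  have hqperp : ∀ n, q n ∈ (V n)ᗮ := fun n => Submodule.sub_starProjection_mem_orthogonal _
  have hqmem : ∀ m n, m < n → q m ∈ V n := fun m n hmn =>
    Submodule.sub_mem _ (Submodule.subset_span ⟨m, hmn, rfl⟩)
      (hVmono hmn.le (Submodule.starProjection_apply_mem _ _))
  by_cases hzero : ∃ i : Fin N, q (k + i) = 0
  · obtain ⟨i, hi⟩ := hzero
    have h1 : γ * spanDeviation K x (k + i) ≤ 0 := by
      have := hgreedy (k + i)
      rwa [show infDist (x (k + i)) (Submodule.span ℂ (x '' Set.Iio (k + i)) : Set X) = 0 by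
        rw [← norm_zero (E := X), ← hi]; exact hqnorm _] at this
    have h2 : spanDeviation K x (k + i) ≤ 0 := nonpos_of_mul_nonpos_right h1 hγ0
    have h3 : spanDeviation K x (k + N) ≤ spanDeviation K x (k + i) :=
      spanDeviation_antitone hM (by have := i.2; omega)
    have : 0 ≤ 2 * ε / γ := by positivity
    linarith
  push Not at hzero
  set e : Fin N → X := fun i => ((‖q (k + i)‖⁻¹ : ℝ) : ℂ) • q (k + i) with he_def
  have hqpos : ∀ i : Fin N, 0 < ‖q (k + i)‖ := fun i => norm_pos_iff.2 (hzero i)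
  have he : Orthonormal ℂ e := by
    have hlt : ∀ m n, m < n → inner ℂ (q m) (q n) = 0 := fun m n hmn =>
      (Submodule.mem_orthogonal _ _).1 (hqperp n) _ (hqmem m n hmn)
    refine ⟨fun i => ?_, fun i j hij => ?_⟩
    · simp only [he_def, norm_smul, Complex.norm_real, norm_inv, norm_norm]
      exact inv_mul_cancel₀ (hqpos i).ne'
    · have : inner ℂ (q (k + i)) (q (k + j)) = 0 := by
        rcases lt_or_gt_of_ne (Fin.val_ne_of_ne hij) with h | h
        · exact hlt _ _ (by omega)
        · exact inner_eq_zero_symm.1 (hlt _ _ (by omega))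
      simp [he_def, inner_smul_left, inner_smul_right, this]
  set Q : X →L[ℂ] X := (V k)ᗮ.starProjection with hQ
  have hQapply : ∀ y, Q y = y - (V k).starProjection y := fun y => by
    rw [hQ, Submodule.starProjection_orthogonal']; rfl
  have hfdmap : FiniteDimensional ℂ (W.map (Q : X →ₗ[ℂ] X)) := inferInstance
  set W' : Submodule ℂ X := W.map (Q : X →ₗ[ℂ] X) with hW'
  have : FiniteDimensional ℂ W' := hfdmap
  have hdim : (Module.finrank ℂ W' : ℝ) ≤ Module.finrank ℂ W := by
    exact_mod_cast Submodule.finrank_map_le _ _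
  obtain ⟨i, hi⟩ : ∃ i : Fin N, ‖W'.starProjection (e i)‖ ^ 2 ≤ (γ / 2) ^ 2 := by
    by_contra! hcon
    have h1 := he.sum_sq_norm_starProjection_le W'
    have h2 : ∑ _i : Fin N, (γ / 2) ^ 2 < ∑ i, ‖W'.starProjection (e i)‖ ^ 2 :=
      Finset.sum_lt_sum_of_nonempty ⟨⟨0, hN⟩, Finset.mem_univ _⟩ fun i _ => hcon i
    simp only [Finset.sum_const, Finset.card_univ, Fintype.card_fin, nsmul_eq_mul] at h2
    nlinarith
  have hi' : ‖W'.starProjection (e i)‖ ≤ γ / 2 := le_of_sq_le_sq hi (by positivity)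
  obtain ⟨w, hwW, hw⟩ := hW _ (hxK (k + i))
  have hQx : ‖Q (x (k + i))‖ ≤ spanDeviation K x k := by
    rw [hQapply, ← infDist_eq_norm_sub_starProjection]
    exact infDist_le_spanDeviation hM k (hxK _)
  have hQr : ‖Q (x (k + i) - w)‖ ≤ ε := (Submodule.norm_starProjection_apply_le _ _).trans hw
  have hQw : ‖Q w‖ ≤ spanDeviation K x k + ε := by
    have : Q w = Q (x (k + i)) - Q (x (k + i) - w) := by rw [map_sub]; abel
    rw [this]
    exact (norm_sub_le _ _).trans (add_le_add hQx hQr)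
  have heperp : e i ∈ (V (k + i))ᗮ := Submodule.smul_mem _ _ (hqperp _)
  have heperp' : e i ∈ (V k)ᗮ := Submodule.orthogonal_le (hVmono (Nat.le_add_right k i)) heperp
  have hQe : Q (e i) = e i := Submodule.starProjection_eq_self_iff.2 heperp'
  have h1 : inner ℂ (e i) (x (k + i)) = ((‖q (k + i)‖ : ℝ) : ℂ) := by
    have hx : x (k + i) = q (k + i) + (V (k + i)).starProjection (x (k + i)) := by simp [hq]
    have h0 : inner ℂ (e i) ((V (k + i)).starProjection (x (k + i))) = 0 :=
      inner_eq_zero_symm.1 ((Submodule.mem_orthogonal _ _).1 heperp _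
        (Submodule.starProjection_apply_mem _ _))
    have hne : ((‖q (k + i)‖ : ℝ) : ℂ) ≠ 0 := by exact_mod_cast (hqpos i).ne'
    rw [hx, inner_add_right, h0, add_zero]
    simp only [he_def, inner_smul_left, Complex.conj_ofReal, inner_self_eq_norm_sq_to_K]
    push_cast
    field_simp
    simp
  have h2 : inner ℂ (e i) (x (k + i))
      = inner ℂ (W'.starProjection (e i)) (Q w) + inner ℂ (e i) (Q (x (k + i) - w)) := by
    have hQwW : W'.starProjection (Q w) = Q w :=
      Submodule.starProjection_eq_self_iff.2 (Submodule.mem_map_of_mem hwW)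
    rw [Submodule.inner_starProjection_left_eq_right, hQwW, ← inner_add_right, ← map_add,
      add_sub_cancel, hQ, ← Submodule.inner_starProjection_left_eq_right, ← hQ, hQe]
  have h3 : ‖q (k + i)‖ ≤ γ / 2 * (spanDeviation K x k + ε) + ε := by
    have : ‖q (k + i)‖ = ‖inner ℂ (e i) (x (k + i))‖ := by rw [h1]; simp
    rw [this, h2]
    refine (norm_add_le _ _).trans (add_le_add ?_ ?_)
    · refine (norm_inner_le_norm _ _).trans ?_
      gcongr
    · refine (norm_inner_le_norm _ _).trans ?_
      rw [he.1 i, one_mul]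
      exact hQr
  have h4 : γ * spanDeviation K x (k + N) ≤ ‖q (k + i)‖ := by
    refine le_trans ?_ ((hgreedy (k + i)).trans (hqnorm _).le)
    gcongr
    exact spanDeviation_antitone hM (by have := i.2; omega)
  have h5 : γ * spanDeviation K x (k + N) ≤ γ * (spanDeviation K x k / 2 + 2 * ε / γ) := by
    have : γ * (spanDeviation K x k / 2 + 2 * ε / γ) = γ * spanDeviation K x k / 2 + 2 * ε := by
      field_simp
    rw [this]
    nlinarith
  exact le_of_mul_le_mul_left h5 hγ0

/-- Iterating `spanDeviation_add_le`. -/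
theorem spanDeviation_mul_le (hM : ∀ y ∈ K, ‖y‖ ≤ M) (hxK : ∀ n, x n ∈ K) {γ : ℝ} (hγ0 : 0 < γ)
    (hγ1 : γ ≤ 1)
    (hgreedy : ∀ n : ℕ, γ * spanDeviation K x n ≤
      infDist (x n) (Submodule.span ℂ (x '' Set.Iio n) : Set X))
    {W : Submodule ℂ X} [FiniteDimensional ℂ W] {ε : ℝ} (hε : 0 ≤ ε)
    (hW : ∀ y ∈ K, ∃ w ∈ W, ‖y - w‖ ≤ ε) (N : ℕ) (hN : 0 < N)
    (hWN : 4 * (Module.finrank ℂ W : ℝ) ≤ γ ^ 2 * N) (j : ℕ) :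
    spanDeviation K x (j * N) ≤ M * (1 / 2) ^ j + 4 * ε / γ := by
  induction j with
  | zero =>
    have hM0 : 0 ≤ M := (norm_nonneg _).trans (hM _ (hxK 0))
    have := spanDeviation_le (x := x) hM hM0 (0 * N)
    have : 0 ≤ 4 * ε / γ := by positivity
    simp only [pow_zero, mul_one]
    linarith
  | succ j ih =>
    have h := spanDeviation_add_le hM hxK hγ0 hγ1 hgreedy hε hW (j * N) N hN hWN
    rw [add_mul, one_mul, pow_succ]
    refine h.trans ?_
    have : 4 * ε / γ = 2 * (2 * ε / γ) := by ring
    linarith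

end Greedy

/-- Holomorphic functions of several variables are approximated near each point, at a geometric
rate, by subspaces of polynomially growing dimension. -/
theorem exists_local_span_approx {d : ℕ} {X : Type*} [NormedAddCommGroup X] [NormedSpace ℂ X]
    [CompleteSpace X] {O : Set (EuclideanSpace ℂ (Fin d))} (hO : IsOpen O)
    {u : EuclideanSpace ℂ (Fin d) → X} (hu : DifferentiableOn ℂ u O) {M : ℝ}
    (hM : ∀ z ∈ O, ‖u z‖ ≤ M) {c : EuclideanSpace ℂ (Fin d)} (hc : c ∈ O) :
    ∃ r > 0, ∀ n : ℕ, n ≠ 0 → ∃ p : (Fin d → Fin n) → X, ∀ y ∈ ball c r,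
      ∃ w ∈ Submodule.span ℂ (Set.range p), ‖u y - w‖ ≤ (2 ^ d - 1) * (6 * M * (1 / 2) ^ n) := by
  obtain ⟨ε, hε, hεO⟩ := Metric.isOpen_iff.1 hO c hc
  set T : (Fin d → ℂ) →L[ℂ] EuclideanSpace ℂ (Fin d) :=
    (PiLp.continuousLinearEquiv 2 ℂ fun _ : Fin d => ℂ).symm.toContinuousLinearMap
  set r : ℝ := ε / (4 * ‖T‖ + 1) with hr
  have hr0 : 0 < r := by positivity
  have hmem : ∀ w : Fin d → ℂ, (∀ i, ‖w i‖ ≤ 4) → c + (r : ℂ) • T w ∈ O := by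
    intro w hw
    refine hεO ?_
    rw [mem_ball, dist_eq_norm, add_sub_cancel_left, norm_smul, Complex.norm_real,
      Real.norm_of_nonneg hr0.le]
    have h1 : ‖T w‖ ≤ ‖T‖ * 4 :=
      (T.le_opNorm w).trans (by gcongr; exact (pi_norm_le_iff_of_nonneg (by norm_num)).2 hw)
    calc r * ‖T w‖ ≤ r * (‖T‖ * 4) := by gcongr
      _ < r * (4 * ‖T‖ + 1) := by gcongr; linarith
      _ = ε := by rw [hr]; field_simp
  refine ⟨r, hr0, fun n hn => ?_⟩
  obtain ⟨p, hp⟩ := exists_grid_approx (F := fun w => u (c + (r : ℂ) • T w)) (M := M)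
    (fun w hw i => by
      have haff : Differentiable ℂ fun t : ℂ => c + (r : ℂ) • T (Function.update w i t) := by
        have : Differentiable ℂ fun t : ℂ => Function.update w i t :=
          fun t => (hasFDerivAt_update w t).differentiableAt
        fun_prop
      refine hu.comp haff.differentiableOn fun t ht => hmem _ fun k => ?_
      by_cases hki : k = i
      · subst hki
        simpa using ht
      · rw [Function.update_of_ne hki]
        exact hw k) (fun w hw => hM _ (hmem w hw)) n hn
  refine ⟨p, fun y hy => ?_⟩
  have hrc : (r : ℂ) ≠ 0 := by exact_mod_cast hr0.ne'
  set v : EuclideanSpace ℂ (Fin d) := (r : ℂ)⁻¹ • (y - c) with hv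
  have hvn : ‖v‖ ≤ 1 := by
    rw [hv, norm_smul, norm_inv, Complex.norm_real, Real.norm_of_nonneg hr0.le,
      inv_mul_le_iff₀ hr0, mul_one]
    exact (mem_ball_iff_norm.1 hy).le
  obtain ⟨w, hwW, hw⟩ := hp (fun i => v i) fun i => (PiLp.norm_apply_le v i).trans hvn
  have hyv : c + (r : ℂ) • T (fun i => v i) = y := by
    have : T (fun i => v i) = v := rfl
    rw [this, hv, smul_smul, mul_inv_cancel₀ hrc, one_smul]
    abel
  rw [hyv, Fintype.card_fin] at hw
  exact ⟨w, hwW, hw⟩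

/-- The image of a compact set under a bounded holomorphic map is approximated at a geometric rate
by subspaces of polynomially growing dimension. -/
theorem exists_subspace_approx {d : ℕ} {X : Type*} [NormedAddCommGroup X] [NormedSpace ℂ X]
    [CompleteSpace X] {O : Set (EuclideanSpace ℂ (Fin d))} (hO : IsOpen O)
    {u : EuclideanSpace ℂ (Fin d) → X} (hu : DifferentiableOn ℂ u O) {M : ℝ}
    (hM : ∀ z ∈ O, ‖u z‖ ≤ M) {𝒩 : Set (EuclideanSpace ℂ (Fin d))} (h𝒩 : IsCompact 𝒩)
    (h𝒩O : 𝒩 ⊆ O) :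
    ∃ J : ℕ, ∀ n : ℕ, n ≠ 0 → ∃ W : Submodule ℂ X, FiniteDimensional ℂ W ∧
      Module.finrank ℂ W ≤ J * n ^ d ∧
      ∀ y ∈ u '' 𝒩, ∃ w ∈ W, ‖y - w‖ ≤ (2 ^ d - 1) * (6 * M * (1 / 2) ^ n) := by
  choose! r hr hp using fun c (hc : c ∈ O) => exists_local_span_approx hO hu hM hc
  obtain ⟨t, ht, hcover⟩ := h𝒩.elim_nhds_subcover (fun c => ball c (r c))
    fun c hc => ball_mem_nhds c (hr c (h𝒩O hc))
  refine ⟨t.card, fun n hn => ?_⟩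
  choose! p hp using fun c (hc : c ∈ O) => hp c hc n hn
  set b : t × (Fin d → Fin n) → X := fun a => p a.1 a.2
  refine ⟨Submodule.span ℂ (Set.range b), FiniteDimensional.span_of_finite ℂ (Set.finite_range b),
    ?_, ?_⟩
  · refine (finrank_range_le_card b).trans (le_of_eq ?_)
    simp
  · rintro _ ⟨z, hz, rfl⟩
    obtain ⟨c, hct, hzc⟩ := Set.mem_iUnion₂.1 (hcover hz)
    obtain ⟨w, hwW, hw⟩ := hp c (h𝒩O (ht c hct)) z hzc
    refine ⟨w, Submodule.span_mono ?_ hwW, hw⟩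
    rintro _ ⟨j, rfl⟩
    exact ⟨(⟨c, hct⟩, j), rfl⟩

/-- An antitone sequence that decays geometrically along `n ↦ n * (L * n ^ d)` decays faster than
any power. -/
theorem exists_le_mul_rpow_neg {σ : ℕ → ℝ} (hσ : Antitone σ) {L d : ℕ} (hL : 0 < L) {C : ℝ}
    (hC : 0 ≤ C) (h : ∀ n, σ (n * (L * n ^ d)) ≤ C * (1 / 2) ^ n) {α : ℝ} (hα : 0 < α) :
    ∃ D : ℝ, 0 < D ∧ ∀ n : ℕ, 0 < n → σ n ≤ D * (n : ℝ) ^ (-α) := by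
  obtain ⟨q, hq⟩ := exists_nat_ge ((d + 1) * α)
  obtain ⟨B, hB⟩ := (tendsto_pow_const_mul_const_pow_of_abs_lt_one q
    (r := (1 / 2 : ℝ)) (by norm_num [abs_of_pos])).bddAbove_range
  have hB : ∀ n : ℕ, (n : ℝ) ^ q * (1 / 2) ^ n ≤ B := fun n => hB ⟨n, rfl⟩
  have hB0 : 0 ≤ B := le_trans (by positivity) (hB 0)
  have hLr : (0 : ℝ) < L := by exact_mod_cast hL
  refine ⟨C * 2 * B * (L : ℝ) ^ α + 1, by positivity, fun k hk => ?_⟩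
  have hkr : (0 : ℝ) < k := by exact_mod_cast hk
  obtain ⟨n, hn1, hn2⟩ : ∃ n, n * (L * n ^ d) ≤ k ∧ k < (n + 1) * (L * (n + 1) ^ d) := by
    have hex : ∃ m, k < (m + 1) * (L * (m + 1) ^ d) :=
      ⟨k, by
        have : 0 < L * (k + 1) ^ d := by positivity
        nlinarith⟩
    classical
    refine ⟨Nat.find hex, ?_, Nat.find_spec hex⟩
    rcases Nat.eq_zero_or_pos (Nat.find hex) with h0 | h0
    · simp [h0]
    · have := Nat.find_min hex (Nat.sub_lt h0 one_pos)
      rw [Nat.sub_add_cancel (show 1 ≤ Nat.find hex from h0)] at this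
      omega
  have hkn : (k : ℝ) ≤ L * ((n + 1 : ℕ) : ℝ) ^ (d + 1) := by
    have : k ≤ L * (n + 1) ^ (d + 1) := by
      refine hn2.le.trans (le_of_eq ?_)
      ring
    exact_mod_cast this
  have hn1' : (1 : ℝ) ≤ ((n + 1 : ℕ) : ℝ) := by exact_mod_cast Nat.le_add_left 1 n
  have hpow : (k : ℝ) ^ α ≤ (L : ℝ) ^ α * ((n + 1 : ℕ) : ℝ) ^ q := by
    calc (k : ℝ) ^ α ≤ (L * ((n + 1 : ℕ) : ℝ) ^ (d + 1)) ^ α :=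
          Real.rpow_le_rpow hkr.le hkn hα.le
      _ = (L : ℝ) ^ α * ((n + 1 : ℕ) : ℝ) ^ ((d + 1) * α) := by
          rw [Real.mul_rpow hLr.le (by positivity), ← Real.rpow_natCast, ← Real.rpow_mul
            (by positivity)]
          push_cast
          rfl
      _ ≤ (L : ℝ) ^ α * ((n + 1 : ℕ) : ℝ) ^ q := by
          gcongr
          rw [← Real.rpow_natCast]
          exact Real.rpow_le_rpow_of_exponent_le hn1' hq
  rw [Real.rpow_neg hkr.le, ← div_eq_mul_inv, le_div_iff₀ (by positivity)]
  calc σ k * (k : ℝ) ^ α ≤ (C * (1 / 2) ^ n) * (k : ℝ) ^ α := by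
        gcongr
        exact (hσ hn1).trans (h n)
    _ ≤ (C * (1 / 2) ^ n) * ((L : ℝ) ^ α * ((n + 1 : ℕ) : ℝ) ^ q) := by gcongr
    _ = C * 2 * (L : ℝ) ^ α * (((n + 1 : ℕ) : ℝ) ^ q * (1 / 2) ^ (n + 1)) := by
        rw [pow_succ (1 / 2 : ℝ)]; ring
    _ ≤ C * 2 * (L : ℝ) ^ α * B := by
        gcongr
        exact hB (n + 1)
    _ ≤ C * 2 * B * (L : ℝ) ^ α + 1 := by linarith

/-- **Arbitrary polynomial decay of greedy approximation rates under analytic parameter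
dependence.** If `u` is holomorphic and uniformly bounded on an open set `O ⊆ ℂ^d`,
`𝒩 ⊆ O` is compact and `K = u(𝒩)`, then for every weak greedy sequence with constant
`γ ∈ (0,1]` for `K` and every `α > 0` there is `C_α > 0` with `σ_n(K) ≤ C_α n^{−α}`. -/
theorem greedy_rates_arbitrary_polynomial_decay
    {d : ℕ} {X : Type*} [NormedAddCommGroup X] [InnerProductSpace ℂ X] [CompleteSpace X]
    (O : Set (EuclideanSpace ℂ (Fin d))) (hO : IsOpen O)
    (u : EuclideanSpace ℂ (Fin d) → X) (hu : DifferentiableOn ℂ u O)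
    (hbdd : ∃ Mb : ℝ, ∀ z ∈ O, ‖u z‖ ≤ Mb)
    (𝒩 : Set (EuclideanSpace ℂ (Fin d))) (h𝒩 : IsCompact 𝒩) (h𝒩O : 𝒩 ⊆ O)
    (γ : ℝ) (hγ0 : 0 < γ) (hγ1 : γ ≤ 1)
    (x : ℕ → X) (hxK : ∀ n, x n ∈ u '' 𝒩)
    (hgreedy : ∀ n : ℕ,
      γ * (⨆ y : u '' 𝒩, infDist (y : X) (Submodule.span ℂ (x '' Set.Iio n) : Set X)) ≤
        infDist (x n) (Submodule.span ℂ (x '' Set.Iio n) : Set X)) :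
    ∀ α : ℝ, 0 < α → ∃ Cα : ℝ, 0 < Cα ∧
      ∀ n : ℕ, 0 < n →
        (⨆ y : u '' 𝒩, infDist (y : X) (Submodule.span ℂ (x '' Set.Iio n) : Set X)) ≤
          Cα * (n : ℝ) ^ (-α) := by
  obtain ⟨Mb, hMb⟩ := hbdd
  have hK : ∀ y ∈ u '' 𝒩, ‖y‖ ≤ Mb := by
    rintro _ ⟨z, hz, rfl⟩
    exact hMb z (h𝒩O hz)
  have hM0 : 0 ≤ Mb := (norm_nonneg _).trans (hK _ (hxK 0))
  obtain ⟨J, hJ⟩ := exists_subspace_approx hO hu hMb h𝒩 h𝒩O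
  obtain ⟨s, hs⟩ := exists_nat_ge (4 / γ ^ 2)
  have h2d : (0 : ℝ) ≤ 2 ^ d - 1 := by
    linarith [one_le_pow₀ (M₀ := ℝ) (a := 2) (by norm_num) (n := d)]
  have hs' : 4 ≤ γ ^ 2 * s := by
    rw [div_le_iff₀ (by positivity)] at hs
    linarith
  intro α hα
  refine exists_le_mul_rpow_neg (σ := spanDeviation (u '' 𝒩) x) (spanDeviation_antitone hK)
    (L := s * J + 1) (d := d) (Nat.succ_pos _)
    (C := Mb + 4 * ((2 ^ d - 1) * (6 * Mb)) / γ) (by positivity) (fun n => ?_) hα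
  rcases Nat.eq_zero_or_pos n with rfl | hn
  · rw [zero_mul, pow_zero, mul_one]
    have : 0 ≤ 4 * ((2 ^ d - 1) * (6 * Mb)) / γ := by positivity
    linarith [spanDeviation_le (x := x) hK hM0 0]
  · obtain ⟨W, hWfd, hWdim, hW⟩ := hJ n hn.ne'
    refine (spanDeviation_mul_le hK hxK hγ0 hγ1 hgreedy (by positivity) hW
      ((s * J + 1) * n ^ d) (by positivity) ?_ n).trans (le_of_eq (by ring))
    have hdim : (Module.finrank ℂ W : ℝ) ≤ J * (n : ℝ) ^ d := by exact_mod_cast hWdim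
    push_cast
    calc 4 * (Module.finrank ℂ W : ℝ) ≤ 4 * (J * (n : ℝ) ^ d) := by gcongr
      _ ≤ γ ^ 2 * s * (J * (n : ℝ) ^ d) := by gcongr
      _ ≤ γ ^ 2 * ((s * J + 1) * (n : ℝ) ^ d) := by
          have : 0 ≤ γ ^ 2 * (n : ℝ) ^ d := by positivity
          linarith
end
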